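/- arXiv:2504.16901 — 2 statements merged into one kernel-verified Lean document; each statement's English description precedes it below -/
import Mathlib

section
/- Let M ⊨ DB₀ and let n ≥ 0 be a natural number. The following are equivalent: (1) M ⊨ Coll_s(Σ_{n+1}); (2) if n = 0: for every N ⊨ DB₀ with M ≺_{Σ₁} N one has M* ≺_{Σ₁} N; and if n ≥ 1: M ⊨ Coll(Σ_n), and for every N ⊨ DB₀ + Coll(Σ_{n-1}) with M ≺_{Σ_{n+1}} N one has M* ≺_{Σ_{n+1}} N; (3) for every N ⊨ DB₀ with M ≺_{Σ_{n+1}} N one has M* ≺_{Σ_{n+1}} N. -/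
/- A deep embedding of the first-order language of set theory L_∈ = {∈, =},
   with named variables indexed by ℕ. -/

namespace FOSet

/-- Formulas of L_∈ with variables indexed by ℕ. -/
inductive Fml : Type
  | mem : ℕ → ℕ → Fml
  | eq  : ℕ → ℕ → Fml
  | not : Fml → Fml
  | and : Fml → Fml → Fml
  | or  : Fml → Fml → Fml
  | imp : Fml → Fml → Fml
  | all : ℕ → Fml → Fml
  | ex  : ℕ → Fml → Fml

namespace Fml

/-- Free variables of a formula. -/
def fv : Fml → Set ℕ
  | mem i j => {i, j}
  | eq i j  => {i, j}
  | not φ   => φ.fv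
  | and φ ψ => φ.fv ∪ ψ.fv
  | or φ ψ  => φ.fv ∪ ψ.fv
  | imp φ ψ => φ.fv ∪ ψ.fv
  | all i φ => φ.fv \ {i}
  | ex i φ  => φ.fv \ {i}

end Fml

/-- Satisfaction, in the substructure of `(N, E)` with domain `S`, of a formula
under a valuation `v` : quantifiers range over `S`. -/
def SatIn {N : Type} (E : N → N → Prop) (S : Set N) : (ℕ → N) → Fml → Prop
  | v, .mem i j => E (v i) (v j)
  | v, .eq i j  => v i = v j
  | v, .not φ   => ¬ SatIn E S v φ
  | v, .and φ ψ => SatIn E S v φ ∧ SatIn E S v ψ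
  | v, .or φ ψ  => SatIn E S v φ ∨ SatIn E S v ψ
  | v, .imp φ ψ => SatIn E S v φ → SatIn E S v ψ
  | v, .all i φ => ∀ a ∈ S, SatIn E S (Function.update v i a) φ
  | v, .ex i φ  => ∃ a ∈ S, SatIn E S (Function.update v i a) φ

/-- Satisfaction in the full structure `(N, E)`. -/
def Sat {N : Type} (E : N → N → Prop) (v : ℕ → N) (φ : Fml) : Prop :=
  SatIn E Set.univ v φ

/-- Δ₀ (= Σ₀ = Π₀) formulas: every quantifier is bounded, i.e. of the form
`∀ x ∈ y` or `∃ x ∈ y`. -/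
inductive IsDelta0 : Fml → Prop
  | mem (i j : ℕ) : IsDelta0 (Fml.mem i j)
  | eq (i j : ℕ)  : IsDelta0 (Fml.eq i j)
  | not {φ} : IsDelta0 φ → IsDelta0 φ.not
  | and {φ ψ} : IsDelta0 φ → IsDelta0 ψ → IsDelta0 (φ.and ψ)
  | or {φ ψ}  : IsDelta0 φ → IsDelta0 ψ → IsDelta0 (φ.or ψ)
  | imp {φ ψ} : IsDelta0 φ → IsDelta0 ψ → IsDelta0 (φ.imp ψ)
  | ball {i j : ℕ} {φ} : i ≠ j → IsDelta0 φ →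
      IsDelta0 (Fml.all i ((Fml.mem i j).imp φ))
  | bex {i j : ℕ} {φ} : i ≠ j → IsDelta0 φ →
      IsDelta0 (Fml.ex i ((Fml.mem i j).and φ))

/-- The Lévy hierarchy: `(levels n).1` is the class of Σ_n formulas and
`(levels n).2` the class of Π_n formulas. -/
def levels : ℕ → (Fml → Prop) × (Fml → Prop)
  | 0 => (IsDelta0, IsDelta0)
  | n + 1 =>
      (fun φ => ∃ i ψ, (levels n).2 ψ ∧ φ = Fml.ex i ψ,
       fun φ => ∃ i ψ, (levels n).1 ψ ∧ φ = Fml.all i ψ)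

def IsSigma (n : ℕ) : Fml → Prop := (levels n).1

def IsPi (n : ℕ) : Fml → Prop := (levels n).2

variable {M N : Type}

/-- `p` is the (Kuratowski) pair `{a, b}` in the sense of `E`. -/
def IsPairOf (E : M → M → Prop) (p a b : M) : Prop :=
  ∀ w, E w p ↔ (w = a ∨ w = b)

/-- `z` is the ordered pair `(a, b)` (Kuratowski) in the sense of `E`. -/
def IsOPairOf (E : M → M → Prop) (z a b : M) : Prop :=
  ∃ s t, IsPairOf E s a a ∧ IsPairOf E t a b ∧ IsPairOf E z s t

/-- Valuation sending variable 0 to `x` and every other variable to `y`;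
used for formulas φ(x, y) with free variables among {0, 1}. -/
def val2 (x y : M) : ℕ → M := fun k => if k = 0 then x else y

/-- Valuation sending 0 ↦ x, 1 ↦ y, everything else ↦ v;
used for formulas φ(x, y, v) with free variables among {0, 1, 2}. -/
def val3 (x y v : M) : ℕ → M := fun k => if k = 0 then x else if k = 1 then y else v

/-- `M ⊨ Sep(φ)` for φ = φ(x, v) (x is variable 0, v is variable 1):
∀v∀p∃q∀x(x∈q ↔ x∈p ∧ φ(x,v)). -/
def SepAx (E : M → M → Prop) (φ : Fml) : Prop :=
  ∀ v p : M, ∃ q : M, ∀ x : M, E x q ↔ (E x p ∧ Sat E (val2 x v) φ)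

/-- `M ⊨ Sep⁻(φ)` for a parameter-free φ = φ(x) (x is variable 0). -/
def SepMinusAx (E : M → M → Prop) (φ : Fml) : Prop :=
  ∀ p : M, ∃ q : M, ∀ x : M, E x q ↔ (E x p ∧ Sat E (fun _ => x) φ)

/-- `(M, E) ⊨ DB₀`: extensionality, empty set, pairing, union, cartesian
product, and Δ₀ separation. -/
def SatDB0 (E : M → M → Prop) : Prop :=
  (∀ a b : M, (∀ x, E x a ↔ E x b) → a = b) ∧
  (∃ e : M, ∀ x, ¬ E x e) ∧
  (∀ a b : M, ∃ p, IsPairOf E p a b) ∧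
  (∀ a : M, ∃ u, ∀ x, E x u ↔ ∃ y, E y a ∧ E x y) ∧
  (∀ a b : M, ∃ c, ∀ z, E z c ↔ ∃ x y, E x a ∧ E y b ∧ IsOPairOf E z x y) ∧
  (∀ φ, IsDelta0 φ → φ.fv ⊆ {0, 1} → SepAx E φ)

/-- `M ⊨ Coll(φ)` for φ = φ(x, y, v) (x = var 0, y = var 1, v = var 2):
∀v∀p(∀x∈p ∃y φ → ∃q ∀x∈p ∃y∈q φ). -/
def CollAx (E : M → M → Prop) (φ : Fml) : Prop :=
  ∀ v p : M, (∀ x, E x p → ∃ y, Sat E (val3 x y v) φ) →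
    ∃ q, ∀ x, E x p → ∃ y, E y q ∧ Sat E (val3 x y v) φ

/-- `M ⊨ Coll_s(φ)`: ∀v∀p∃q∀x∈p(∃y φ ↔ ∃y∈q φ). -/
def CollSAx (E : M → M → Prop) (φ : Fml) : Prop :=
  ∀ v p : M, ∃ q, ∀ x, E x p →
    ((∃ y, Sat E (val3 x y v) φ) ↔ ∃ y, E y q ∧ Sat E (val3 x y v) φ)

/-- `M ⊨ Coll_w(φ)`: ∀v(∀x∃y φ → ∀p∃q∀x∈p∃y∈q φ). -/
def CollWAx (E : M → M → Prop) (φ : Fml) : Prop :=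
  ∀ v : M, (∀ x, ∃ y, Sat E (val3 x y v) φ) →
    ∀ p, ∃ q, ∀ x, E x p → ∃ y, E y q ∧ Sat E (val3 x y v) φ

/-- `M ⊨ Coll⁻(φ)` for a parameter-free φ = φ(x, y) (x = var 0, y = var 1). -/
def CollMinusAx (E : M → M → Prop) (φ : Fml) : Prop :=
  ∀ p : M, (∀ x, E x p → ∃ y, Sat E (val2 x y) φ) →
    ∃ q, ∀ x, E x p → ∃ y, E y q ∧ Sat E (val2 x y) φ

/-- `M ⊨ Coll_w⁻(φ)` for a parameter-free φ = φ(x, y). -/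
def CollWMinusAx (E : M → M → Prop) (φ : Fml) : Prop :=
  (∀ x : M, ∃ y, Sat E (val2 x y) φ) →
    ∀ p, ∃ q, ∀ x, E x p → ∃ y, E y q ∧ Sat E (val2 x y) φ

/-- `M ⊨ Coll_s⁻(φ)` for a parameter-free φ = φ(x, y). -/
def CollSMinusAx (E : M → M → Prop) (φ : Fml) : Prop :=
  ∀ p : M, ∃ q, ∀ x, E x p →
    ((∃ y, Sat E (val2 x y) φ) ↔ ∃ y, E y q ∧ Sat E (val2 x y) φ)

/- Schemas over a class Γ of formulas. -/

def CollScheme (E : M → M → Prop) (Γ : Fml → Prop) : Prop :=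
  ∀ φ, Γ φ → φ.fv ⊆ {0, 1, 2} → CollAx E φ

def CollSScheme (E : M → M → Prop) (Γ : Fml → Prop) : Prop :=
  ∀ φ, Γ φ → φ.fv ⊆ {0, 1, 2} → CollSAx E φ

def CollWScheme (E : M → M → Prop) (Γ : Fml → Prop) : Prop :=
  ∀ φ, Γ φ → φ.fv ⊆ {0, 1, 2} → CollWAx E φ

def CollMinusScheme (E : M → M → Prop) (Γ : Fml → Prop) : Prop :=
  ∀ φ, Γ φ → φ.fv ⊆ {0, 1} → CollMinusAx E φ

def CollWMinusScheme (E : M → M → Prop) (Γ : Fml → Prop) : Prop :=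
  ∀ φ, Γ φ → φ.fv ⊆ {0, 1} → CollWMinusAx E φ

def CollSMinusScheme (E : M → M → Prop) (Γ : Fml → Prop) : Prop :=
  ∀ φ, Γ φ → φ.fv ⊆ {0, 1} → CollSMinusAx E φ

def SepScheme (E : M → M → Prop) (Γ : Fml → Prop) : Prop :=
  ∀ φ, Γ φ → φ.fv ⊆ {0, 1} → SepAx E φ

def SepMinusScheme (E : M → M → Prop) (Γ : Fml → Prop) : Prop :=
  ∀ φ, Γ φ → φ.fv ⊆ {0} → SepMinusAx E φ

/- Extensions. We present an extension `M ⊆ N` by an embedding `f : M → N`. -/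

/-- `f` embeds `(M, EM)` as a substructure of `(N, EN)`. -/
def SubStr (EM : M → M → Prop) (EN : N → N → Prop) (f : M → N) : Prop :=
  Function.Injective f ∧ ∀ a b : M, EM a b ↔ EN (f a) (f b)

/-- `f : M → N` is a (fully) elementary embedding. -/
def ElemEmb (EM : M → M → Prop) (EN : N → N → Prop) (f : M → N) : Prop :=
  ∀ (φ : Fml) (v : ℕ → M), Sat EM v φ ↔ Sat EN (f ∘ v) φ

/-- `f : M → N` is a Σ_n-elementary embedding (M ≺_{Σ_n} N). -/
def SigmaElemEmb (n : ℕ) (EM : M → M → Prop) (EN : N → N → Prop) (f : M → N) : Prop :=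
  ∀ φ, IsSigma n φ → ∀ v : ℕ → M, Sat EM v φ ↔ Sat EN (f ∘ v) φ

/-- `f : M → N` is a Δ₀-elementary embedding (M ≺_{Δ₀} N). -/
def Delta0ElemEmb (EM : M → M → Prop) (EN : N → N → Prop) (f : M → N) : Prop :=
  ∀ φ, IsDelta0 φ → ∀ v : ℕ → M, Sat EM v φ ↔ Sat EN (f ∘ v) φ

/-- The convex hull M* of (the image of) M in N:
{a ∈ N : N ⊨ a ∈ m for some m ∈ M}. -/
def hull (EN : N → N → Prop) (f : M → N) : Set N := {a | ∃ m : M, EN a (f m)}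

/-- The substructure of `N` with domain `S` is a Σ_n-elementary substructure of
`N` (S ≺_{Σ_n} N). -/
def SigmaElemInTop (n : ℕ) (EN : N → N → Prop) (S : Set N) : Prop :=
  ∀ φ, IsSigma n φ → ∀ v : ℕ → N, (∀ k, v k ∈ S) → (SatIn EN S v φ ↔ Sat EN v φ)

/-- The substructure of `N` with domain `S` is a fully elementary substructure. -/
def ElemInTop (EN : N → N → Prop) (S : Set N) : Prop :=
  ∀ (φ : Fml) (v : ℕ → N), (∀ k, v k ∈ S) → (SatIn EN S v φ ↔ Sat EN v φ)

/-- `f` is a Σ_n-elementary embedding of `M` into the substructure of `N` with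
domain `S` (e.g. M ≺_{Σ_n} M*). -/
def SigmaElemEmbInto (n : ℕ) (EM : M → M → Prop) (EN : N → N → Prop) (f : M → N)
    (S : Set N) : Prop :=
  ∀ φ, IsSigma n φ → ∀ v : ℕ → M, Sat EM v φ ↔ SatIn EN S (f ∘ v) φ

/-- `f` is a fully elementary embedding of `M` into the substructure of `N`
with domain `S`. -/
def ElemEmbInto (EM : M → M → Prop) (EN : N → N → Prop) (f : M → N) (S : Set N) : Prop :=
  ∀ (φ : Fml) (v : ℕ → M), Sat EM v φ ↔ SatIn EN S (f ∘ v) φ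

/-- The extension presented by `f` is an end extension. -/
def IsEndEmb (EN : N → N → Prop) (f : M → N) : Prop :=
  ∀ (m : M) (a : N), EN a (f m) → ∃ m', f m' = a

/-- The extension presented by `f` is cofinal. -/
def Cofinal (EN : N → N → Prop) (f : M → N) : Prop :=
  ∀ a : N, ∃ m : M, EN a (f m)

/-- `a` is a transitive set in the sense of `(N, EN)`. -/
def TransIn (EN : N → N → Prop) (a : N) : Prop :=
  ∀ x, EN x a → ∀ y, EN y x → EN y a

/-- The extension presented by `f` is taller. -/
def Taller (EN : N → N → Prop) (f : M → N) : Prop :=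
  ∃ a : N, ∀ m : M, EN (f m) a

/-- The extension presented by `f` is taller*. -/
def TallerStar (EN : N → N → Prop) (f : M → N) : Prop :=
  ∃ a : N, (∀ m : M, EN (f m) a) ∧ TransIn EN a

/-- Property end_n: for every elementary extension N of M, M* ≺_{Σ_n} N. -/
def HasEnd (n : ℕ) (EM : M → M → Prop) : Prop :=
  ∀ (N : Type) (EN : N → N → Prop) (f : M → N), ElemEmb EM EN f →
    SigmaElemInTop n EN (hull EN f)

/-- Property cof_n: for every elementary extension N of M, M ≺_{Σ_n} M*. -/
def HasCof (n : ℕ) (EM : M → M → Prop) : Prop :=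
  ∀ (N : Type) (EN : N → N → Prop) (f : M → N), ElemEmb EM EN f →
    SigmaElemEmbInto n EM EN f (hull EN f)

/-- Property COF_n: for every Δ₀-elementary cofinal extension N of M with
N ⊨ DB₀, M ≺_{Σ_n} N. -/
def HasCOF (n : ℕ) (EM : M → M → Prop) : Prop :=
  ∀ (N : Type) (EN : N → N → Prop) (f : M → N), SatDB0 EN →
    Delta0ElemEmb EM EN f → Cofinal EN f → SigmaElemEmb n EM EN f

/-- TCo: every set is an element of some transitive set. -/
def SatTCo (E : M → M → Prop) : Prop :=
  ∀ a : M, ∃ t, E a t ∧ TransIn E t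

/-- `a` is an ordinal in the sense of `(M, E)`: a transitive set linearly
ordered by `E`. -/
def OrdIn (E : M → M → Prop) (a : M) : Prop :=
  TransIn E a ∧ ∀ x y, E x a → E y a → (E x y ∨ x = y ∨ E y x)

/-- The formula φ(p, α, v) (p = var 0, α = var 1, v = var 2), with parameter
`v ∈ M`, defines a resolution on `(M, E)`. -/
def IsResolution (E : M → M → Prop) (φ : Fml) (v : M) : Prop :=
  φ.fv ⊆ {0, 1, 2} ∧
  (∀ α, OrdIn E α → ∃! p, Sat E (val3 p α v) φ) ∧
  (∀ α β p q, E α β → Sat E (val3 p α v) φ → Sat E (val3 q β v) φ →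
    ∀ x, E x p → E x q) ∧
  (∀ x, ∃ α, OrdIn E α ∧ ∀ p, Sat E (val3 p α v) φ → E x p)

end FOSet

namespace FOSet

open Function

section Semantics

variable {N : Type} {E : N → N → Prop} {S : Set N} {v w : ℕ → N} {φ ψ : Fml} {i j : ℕ}

theorem Fml.fv_finite (φ : Fml) : φ.fv.Finite := by
  induction φ with
  | mem i j => simp [fv]
  | eq i j => simp [fv]
  | not φ h => exact h
  | and φ ψ h h' => exact h.union h'
  | or φ ψ h h' => exact h.union h'
  | imp φ ψ h h' => exact h.union h'
  | all i φ h => exact h.sdiff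
  | ex i φ h => exact h.sdiff

theorem satIn_congr (h : ∀ k ∈ φ.fv, v k = w k) : SatIn E S v φ ↔ SatIn E S w φ := by
  induction φ generalizing v w with
  | mem i j => simp [SatIn, h i (by simp [Fml.fv]), h j (by simp [Fml.fv])]
  | eq i j => simp [SatIn, h i (by simp [Fml.fv]), h j (by simp [Fml.fv])]
  | not φ ih => exact not_congr (ih h)
  | and φ ψ h1 h2 =>
    exact and_congr (h1 fun k hk => h k (.inl hk)) (h2 fun k hk => h k (.inr hk))
  | or φ ψ h1 h2 =>
    exact or_congr (h1 fun k hk => h k (.inl hk)) (h2 fun k hk => h k (.inr hk))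
  | imp φ ψ h1 h2 =>
    exact imp_congr (h1 fun k hk => h k (.inl hk)) (h2 fun k hk => h k (.inr hk))
  | all i φ ih =>
    refine forall₂_congr fun a _ => ih fun k hk => ?_
    by_cases hki : k = i
    · simp [hki]
    · simpa [hki] using h k ⟨hk, hki⟩
  | ex i φ ih =>
    refine exists_congr fun a => and_congr_right fun _ => ih fun k hk => ?_
    by_cases hki : k = i
    · simp [hki]
    · simpa [hki] using h k ⟨hk, hki⟩

theorem sat_congr (h : ∀ k ∈ φ.fv, v k = w k) : Sat E v φ ↔ Sat E w φ := satIn_congr h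

@[simp] theorem sat_mem : Sat E v (.mem i j) ↔ E (v i) (v j) := Iff.rfl
@[simp] theorem sat_eq : Sat E v (.eq i j) ↔ v i = v j := Iff.rfl
@[simp] theorem sat_not : Sat E v (.not φ) ↔ ¬ Sat E v φ := Iff.rfl
@[simp] theorem sat_and : Sat E v (.and φ ψ) ↔ Sat E v φ ∧ Sat E v ψ := Iff.rfl
@[simp] theorem sat_or : Sat E v (.or φ ψ) ↔ Sat E v φ ∨ Sat E v ψ := Iff.rfl
@[simp] theorem sat_imp : Sat E v (.imp φ ψ) ↔ (Sat E v φ → Sat E v ψ) := Iff.rfl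
@[simp] theorem sat_all : Sat E v (.all i φ) ↔ ∀ a, Sat E (update v i a) φ := by
  simp [Sat, SatIn]
@[simp] theorem sat_ex : Sat E v (.ex i φ) ↔ ∃ a, Sat E (update v i a) φ := by
  simp [Sat, SatIn]

end Semantics

/-! ### Renaming of variables -/

/-- A natural number outside the set `s`, provided `s` is finite. -/
noncomputable def fresh (s : Set ℕ) : ℕ := sInf sᶜ

theorem fresh_notMem {s : Set ℕ} (hs : s.Finite) : fresh s ∉ s :=
  Nat.sInf_mem hs.infinite_compl.nonempty

/-- Capture-avoiding renaming of the free variables of a formula. -/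
noncomputable def Fml.ren : (ℕ → ℕ) → Fml → Fml
  | ρ, .mem i j => .mem (ρ i) (ρ j)
  | ρ, .eq i j => .eq (ρ i) (ρ j)
  | ρ, .not φ => .not (φ.ren ρ)
  | ρ, .and φ ψ => .and (φ.ren ρ) (ψ.ren ρ)
  | ρ, .or φ ψ => .or (φ.ren ρ) (ψ.ren ρ)
  | ρ, .imp φ ψ => .imp (φ.ren ρ) (ψ.ren ρ)
  | ρ, .all i φ => .all (fresh (ρ '' φ.fv)) (φ.ren (update ρ i (fresh (ρ '' φ.fv))))
  | ρ, .ex i φ => .ex (fresh (ρ '' φ.fv)) (φ.ren (update ρ i (fresh (ρ '' φ.fv))))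

theorem image_update_diff_subset (ρ : ℕ → ℕ) (i b : ℕ) (s : Set ℕ) :
    (update ρ i b '' s) \ {b} ⊆ ρ '' (s \ {i}) := by
  rintro _ ⟨⟨k, hk, rfl⟩, hb⟩
  have hki : k ≠ i := by
    rintro rfl
    simp at hb
  exact ⟨k, ⟨hk, hki⟩, by simp [hki]⟩

theorem Fml.fv_ren (φ : Fml) (ρ : ℕ → ℕ) : (φ.ren ρ).fv ⊆ ρ '' φ.fv := by
  induction φ generalizing ρ with
  | mem i j => simp [ren, fv, Set.image_pair]
  | eq i j => simp [ren, fv, Set.image_pair]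
  | not φ h => exact h ρ
  | and φ ψ h h' => simpa only [ren, fv, Set.image_union] using Set.union_subset_union (h ρ) (h' ρ)
  | or φ ψ h h' => simpa only [ren, fv, Set.image_union] using Set.union_subset_union (h ρ) (h' ρ)
  | imp φ ψ h h' => simpa only [ren, fv, Set.image_union] using Set.union_subset_union (h ρ) (h' ρ)
  | all i φ h => exact (Set.sdiff_subset_sdiff_left (h _)).trans (image_update_diff_subset _ _ _ _)
  | ex i φ h => exact (Set.sdiff_subset_sdiff_left (h _)).trans (image_update_diff_subset _ _ _ _)

theorem sat_ren {N : Type} {E : N → N → Prop} (φ : Fml) (ρ : ℕ → ℕ) (v : ℕ → N) :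
    Sat E v (φ.ren ρ) ↔ Sat E (v ∘ ρ) φ := by
  have key : ∀ (φ : Fml) (ρ : ℕ → ℕ) (v : ℕ → N) (i : ℕ) (a : N),
      Sat E (update v (fresh (ρ '' φ.fv)) a ∘ update ρ i (fresh (ρ '' φ.fv))) φ ↔
        Sat E (update (v ∘ ρ) i a) φ := by
    intro φ ρ v i a
    refine sat_congr fun k hk => ?_
    by_cases hki : k = i
    · simp [hki]
    · have : ρ k ≠ fresh (ρ '' φ.fv) := fun h =>
        fresh_notMem (φ.fv_finite.image ρ) (h ▸ ⟨k, hk, rfl⟩)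
      simp [hki, this]
  induction φ generalizing ρ v with
  | mem i j => rfl
  | eq i j => rfl
  | not φ h => exact not_congr (h ρ v)
  | and φ ψ h h' => exact and_congr (h ρ v) (h' ρ v)
  | or φ ψ h h' => exact or_congr (h ρ v) (h' ρ v)
  | imp φ ψ h h' => exact imp_congr (h ρ v) (h' ρ v)
  | all i φ h => simp only [Fml.ren, sat_all, h, key]
  | ex i φ h => simp only [Fml.ren, sat_ex, h, key]

theorem IsDelta0.ren {φ : Fml} (h : IsDelta0 φ) (ρ : ℕ → ℕ) : IsDelta0 (φ.ren ρ) := by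
  induction h generalizing ρ with
  | mem i j => exact .mem _ _
  | eq i j => exact .eq _ _
  | not _ h => exact .not (h ρ)
  | and _ _ h h' => exact .and (h ρ) (h' ρ)
  | or _ _ h h' => exact .or (h ρ) (h' ρ)
  | imp _ _ h h' => exact .imp (h ρ) (h' ρ)
  | @ball i j φ hij _ h =>
    simp only [Fml.ren, update_self, update_of_ne hij.symm]
    refine .ball (fun hb => ?_) (h _)
    refine fresh_notMem ((((Fml.mem i j).imp φ).fv_finite).image ρ) (hb ▸ ⟨j, ?_, rfl⟩)
    simp [Fml.fv]
  | @bex i j φ hij _ h =>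
    simp only [Fml.ren, update_self, update_of_ne hij.symm]
    refine .bex (fun hb => ?_) (h _)
    refine fresh_notMem ((((Fml.mem i j).and φ).fv_finite).image ρ) (hb ▸ ⟨j, ?_, rfl⟩)
    simp [Fml.fv]

/-! ### The Lévy hierarchy, with both polarities treated uniformly -/

/-- The existential (`true`) or universal (`false`) quantifier. -/
def Fml.quant : Bool → ℕ → Fml → Fml
  | true => .ex
  | false => .all

/-- `Lev true k` is the class `Σ_k`, and `Lev false k` is the class `Π_k`. -/
def Lev : Bool → ℕ → Fml → Prop
  | _, 0 => IsDelta0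
  | b, k + 1 => fun φ => ∃ i ψ, Lev (!b) k ψ ∧ φ = Fml.quant b i ψ

theorem levels_eq_lev (k : ℕ) : levels k = (Lev true k, Lev false k) := by
  induction k with
  | zero => rfl
  | succ k ih => simp only [levels, ih]; rfl

theorem isSigma_eq_lev (k : ℕ) : IsSigma k = Lev true k := by simp [IsSigma, levels_eq_lev]

/-- `∃ a, P a` or `∀ a, P a` according to the polarity. -/
def Quant {N : Type} : Bool → (N → Prop) → Prop
  | true, P => ∃ a, P a
  | false, P => ∀ a, P a

theorem sat_quant {N : Type} {E : N → N → Prop} {v : ℕ → N} {b : Bool} {i : ℕ} {φ : Fml} :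
    Sat E v (.quant b i φ) ↔ Quant b fun a => Sat E (update v i a) φ := by
  cases b <;> simp [Fml.quant, Quant]

theorem Quant.congr {N : Type} {b : Bool} {P Q : N → Prop} (h : ∀ a, P a ↔ Q a) :
    Quant b P ↔ Quant b Q := by
  rw [funext fun a => propext (h a)]

theorem Quant.exists {N : Type} [Nonempty N] {b : Bool} {P : N → Prop} (h : Quant b P) :
    ∃ a, P a := by
  cases b
  · exact ⟨Classical.arbitrary N, h _⟩
  · exact h

theorem quant_const {N : Type} [Nonempty N] {b : Bool} {p : Prop} :
    Quant b (fun _ : N => p) ↔ p := by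
  cases b <;> simp [Quant]

theorem Fml.fv_quant (b : Bool) (i : ℕ) (φ : Fml) : (Fml.quant b i φ).fv = φ.fv \ {i} := by
  cases b <;> rfl

theorem Lev.ren {b : Bool} {k : ℕ} {φ : Fml} (h : Lev b k φ) (ρ : ℕ → ℕ) :
    Lev b k (φ.ren ρ) := by
  induction k generalizing b φ ρ with
  | zero => exact IsDelta0.ren h ρ
  | succ k ih =>
    obtain ⟨i, ψ, hψ, rfl⟩ := h
    cases b
    · exact ⟨_, _, ih hψ _, rfl⟩
    · exact ⟨_, _, ih hψ _, rfl⟩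

/-- The negation of a formula of one polarity is equivalent to one of the other polarity. -/
theorem Lev.exists_neg {b : Bool} {k : ℕ} {φ : Fml} (h : Lev b k φ) :
    ∃ φ', Lev (!b) k φ' ∧
      ∀ (N : Type) (E : N → N → Prop) (S : Set N) v, SatIn E S v φ' ↔ ¬ SatIn E S v φ := by
  induction k generalizing b φ with
  | zero => exact ⟨φ.not, .not h, fun _ _ _ _ => Iff.rfl⟩
  | succ k ih =>
    obtain ⟨i, ψ, hψ, rfl⟩ := h
    obtain ⟨ψ', hψ', hs⟩ := ih hψ
    refine ⟨Fml.quant (!b) i ψ', ⟨i, ψ', hψ', rfl⟩, fun N E S v => ?_⟩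
    cases b <;> simp [Fml.quant, SatIn, hs]

/-- Dummy quantifiers raise a formula by one level. -/
theorem Lev.exists_quant (b' : Bool) {b : Bool} {k : ℕ} {φ : Fml} (h : Lev b k φ)
    (hb : b' = !b ∨ k = 0) :
    ∃ φ', Lev b' (k + 1) φ' ∧ φ'.fv ⊆ φ.fv ∧
      ∀ (N : Type) (E : N → N → Prop) v, Sat E v φ' ↔ Sat E v φ := by
  have hl : Lev (!b') k φ := by
    rcases hb with rfl | rfl
    · simpa using h
    · exact h
  refine ⟨Fml.quant b' (fresh φ.fv) φ, ⟨_, _, hl, rfl⟩, ?_, fun N E v => ?_⟩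
  · rw [Fml.fv_quant]; exact Set.sdiff_subset
  · have : Nonempty N := ⟨v 0⟩
    rw [sat_quant, Quant.congr (Q := fun _ => Sat E v φ), quant_const]
    refine fun a => sat_congr fun k hk => update_of_ne ?_ _ _
    rintro rfl
    exact fresh_notMem φ.fv_finite hk

theorem Lev.exists_succ {b : Bool} {k : ℕ} {φ : Fml} (h : Lev b k φ) :
    ∃ φ', Lev b (k + 1) φ' ∧ φ'.fv ⊆ φ.fv ∧
      ∀ (N : Type) (E : N → N → Prop) v, Sat E v φ' ↔ Sat E v φ := by
  induction k generalizing b φ with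
  | zero => exact Lev.exists_quant b h (.inr rfl)
  | succ k ih =>
    obtain ⟨i, ψ, hψ, rfl⟩ := h
    obtain ⟨ψ', hψ', hfv, hs⟩ := ih hψ
    refine ⟨Fml.quant b i ψ', ⟨i, ψ', hψ', rfl⟩, ?_, fun N E v => ?_⟩
    · rw [Fml.fv_quant, Fml.fv_quant]; exact Set.sdiff_subset_sdiff_left hfv
    · rw [sat_quant, sat_quant]; exact Quant.congr fun a => hs N E _

theorem Lev.exists_le {b : Bool} {k n : ℕ} {φ : Fml} (h : Lev b k φ) (hkn : k ≤ n) :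
    ∃ φ', Lev b n φ' ∧ φ'.fv ⊆ φ.fv ∧
      ∀ (N : Type) (E : N → N → Prop) v, Sat E v φ' ↔ Sat E v φ := by
  induction n, hkn using Nat.le_induction with
  | base => exact ⟨φ, h, subset_rfl, fun _ _ _ => Iff.rfl⟩
  | succ n _ ih =>
    obtain ⟨φ', h', hfv, hs⟩ := ih
    obtain ⟨φ'', h'', hfv', hs'⟩ := h'.exists_succ
    exact ⟨φ'', h'', hfv'.trans hfv, fun N E v => (hs' N E v).trans (hs N E v)⟩

/-- The conjunction of a `Δ₀` formula with a formula of a given level stays at that level. -/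
theorem Lev.exists_and {b : Bool} {k : ℕ} {φ δ : Fml} (hδ : IsDelta0 δ) (h : Lev b k φ) :
    ∃ φ', Lev b k φ' ∧
      ∀ (N : Type) (E : N → N → Prop) v, Sat E v φ' ↔ (Sat E v δ ∧ Sat E v φ) := by
  induction k generalizing b φ δ with
  | zero => exact ⟨δ.and φ, .and hδ h, fun _ _ _ => Iff.rfl⟩
  | succ k ih =>
    obtain ⟨i, ψ, hψ, rfl⟩ := h
    set j := fresh (δ.fv ∪ ψ.fv) with hj
    have hjf : j ∉ δ.fv ∪ ψ.fv := fresh_notMem (δ.fv_finite.union ψ.fv_finite)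
    obtain ⟨ψ', hψ', hs⟩ := ih hδ (hψ.ren (update id i j))
    refine ⟨Fml.quant b j ψ', ⟨j, ψ', hψ', rfl⟩, fun N E v => ?_⟩
    have : Nonempty N := ⟨v 0⟩
    rw [sat_quant, sat_quant,
      Quant.congr (Q := fun a => Sat E v δ ∧ Sat E (update v i a) ψ)]
    · cases b <;> simp [Quant, forall_and]
    · intro a
      rw [hs, sat_ren]
      refine and_congr (sat_congr fun l hl => update_of_ne ?_ _ _) (sat_congr fun l hl => ?_)
      · rintro rfl; exact hjf (.inl hl)
      · by_cases hli : l = i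
        · simp [hli]
        · have : l ≠ j := by rintro rfl; exact hjf (.inr hl)
          simp [hli, this]

end FOSet

namespace FOSet

open Function

/-! ### Ordered pairs -/

theorem IsOPairOf.inj {N : Type} {E : N → N → Prop} {p a b a' b' : N}
    (h : IsOPairOf E p a b) (h' : IsOPairOf E p a' b') : a = a' ∧ b = b' := by
  obtain ⟨s, t, hs, ht, hp⟩ := h
  obtain ⟨s', t', hs', ht', hp'⟩ := h'
  have h1 := (hp s').1 ((hp' s').2 (.inl rfl))
  have h2 := (hp t').1 ((hp' t').2 (.inr rfl))
  have h3 := (hp' s).1 ((hp s).2 (.inl rfl))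
  have h4 := (hp' t).1 ((hp t).2 (.inr rfl))
  have e1 := hs a
  have e2 := hs' a'
  have e3 := ht a
  have e4 := ht b
  have e5 := ht' a'
  have e6 := ht' b'
  have e7 := ht' a
  have e8 := ht' b
  have e9 := ht a'
  have e10 := ht b'
  have e11 := hs' a
  have e12 := hs' b
  have e13 := hs a'
  have e14 := hs b'
  grind

theorem SatDB0.exists_oPair {N : Type} {E : N → N → Prop} (h : SatDB0 E) (a b : N) :
    ∃ p, IsOPairOf E p a b := by
  obtain ⟨s, hs⟩ := h.2.2.1 a a
  obtain ⟨t, ht⟩ := h.2.2.1 a b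
  obtain ⟨p, hp⟩ := h.2.2.1 s t
  exact ⟨p, s, t, hs, ht, hp⟩

/-- `IsOPairOf` is `Δ₀`. -/
theorem exists_oPairFml (z x y : ℕ) : ∃ δ : Fml, IsDelta0 δ ∧ δ.fv ⊆ {z, x, y} ∧
    ∀ (N : Type) (E : N → N → Prop) v, Sat E v δ ↔ IsOPairOf E (v z) (v x) (v y) := by
  let pr : ℕ → ℕ → ℕ → Fml := fun p a b =>
    (Fml.all 5 ((Fml.mem 5 p).imp ((Fml.eq 5 a).or (Fml.eq 5 b)))).and
      ((Fml.mem a p).and (Fml.mem b p))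
  let δ : Fml := .ex 3 ((Fml.mem 3 0).and (.ex 4 ((Fml.mem 4 0).and
    ((pr 3 1 1).and ((pr 4 1 2).and (pr 0 3 4))))))
  have hpr : ∀ p a b, p ≠ 5 → IsDelta0 (pr p a b) := fun p a b hp =>
    .and (.ball hp.symm (.or (.eq _ _) (.eq _ _))) (.and (.mem _ _) (.mem _ _))
  have hδ : IsDelta0 δ := .bex (by decide) (.bex (by decide)
    (.and (hpr _ _ _ (by decide)) (.and (hpr _ _ _ (by decide)) (hpr _ _ _ (by decide)))))
  have hfv : δ.fv ⊆ {0, 1, 2} := by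
    intro k hk
    simp [δ, pr, Fml.fv] at hk
    simp
    omega
  have hsat : ∀ (N : Type) (E : N → N → Prop) v,
      Sat E v δ ↔ IsOPairOf E (v 0) (v 1) (v 2) := by
    intro N E v
    simp only [δ, pr, sat_ex, sat_and, sat_mem, sat_all, sat_imp, sat_or, sat_eq, update_apply,
      IsOPairOf, IsPairOf]
    simp only [Nat.reduceEqDiff, reduceIte, OfNat.zero_ne_ofNat, OfNat.one_ne_ofNat]
    constructor
    · rintro ⟨s, -, t, -, ⟨h1, h2, -⟩, ⟨h3, h4, h5⟩, h6, h7, h8⟩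
      refine ⟨s, t, fun w => ⟨h1 w, ?_⟩, fun w => ⟨h3 w, ?_⟩, fun w => ⟨h6 w, ?_⟩⟩ <;>
        rintro (rfl | rfl) <;> assumption
    · rintro ⟨s, t, h1, h2, h3⟩
      exact ⟨s, (h3 s).2 (.inl rfl), t, (h3 t).2 (.inr rfl),
        ⟨fun w => (h1 w).1, (h1 _).2 (.inl rfl), (h1 _).2 (.inl rfl)⟩,
        ⟨fun w => (h2 w).1, (h2 _).2 (.inl rfl), (h2 _).2 (.inr rfl)⟩,
        ⟨fun w => (h3 w).1, (h3 _).2 (.inl rfl), (h3 _).2 (.inr rfl)⟩⟩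
  refine ⟨δ.ren fun k => if k = 0 then z else if k = 1 then x else y, hδ.ren _, ?_, ?_⟩
  · refine (δ.fv_ren _).trans ((Set.image_mono hfv).trans ?_)
    simp [Set.image_insert_eq]
  · intro N E v
    rw [sat_ren, hsat]
    simp

/-- The `Δ₀` formula expressing that variable `z` is the ordered pair of variables `x`, `y`. -/
noncomputable def oPairFml (z x y : ℕ) : Fml := (exists_oPairFml z x y).choose

theorem isDelta0_oPairFml (z x y : ℕ) : IsDelta0 (oPairFml z x y) :=
  (exists_oPairFml z x y).choose_spec.1

theorem fv_oPairFml (z x y : ℕ) : (oPairFml z x y).fv ⊆ {z, x, y} :=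
  (exists_oPairFml z x y).choose_spec.2.1

@[simp] theorem sat_oPairFml {N : Type} {E : N → N → Prop} {v : ℕ → N} {z x y : ℕ} :
    Sat E v (oPairFml z x y) ↔ IsOPairOf E (v z) (v x) (v y) :=
  (exists_oPairFml z x y).choose_spec.2.2 N E v

/-- Two free variables `d`, `c` of a formula can be replaced by a single one standing for the
ordered pair of their values. -/
theorem Lev.exists_pairing {b : Bool} {k : ℕ} {φ : Fml} (h : Lev b k φ) {d c : ℕ} (hdc : d ≠ c) :
    ∃ φ', Lev b k φ' ∧ φ'.fv ⊆ insert c (φ.fv \ {d}) ∧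
      ∀ (N : Type) (E : N → N → Prop) v,
        (∀ y z, IsOPairOf E (v c) y z →
          (Sat E v φ' ↔ Sat E (update (update v d y) c z) φ)) ∧
        (Sat E v φ' → ∃ y z, IsOPairOf E (v c) y z) := by
  induction k generalizing b φ with
  | zero =>
    obtain ⟨e, he⟩ : ∃ e, e ∉ φ.fv ∪ {d, c} :=
      ⟨_, fresh_notMem (φ.fv_finite.union (by simp))⟩
    obtain ⟨s, hs⟩ : ∃ s, s ∉ φ.fv ∪ {d, c, e} :=
      ⟨_, fresh_notMem (φ.fv_finite.union (by simp))⟩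
    simp only [Set.mem_union, Set.mem_insert_iff, Set.mem_singleton_iff, not_or, ← ne_eq] at he hs
    obtain ⟨he, hed, hec⟩ := he
    obtain ⟨hs, hsd, hsc, hse⟩ := hs
    let θ : Fml := .ex s ((Fml.mem s e).and (.ex d ((Fml.mem d s).and
      (.ex s ((Fml.mem s e).and (.ex c ((Fml.mem c s).and ((oPairFml e d c).and φ))))))))
    have hθ : IsDelta0 θ := .bex hse (.bex hsd.symm (.bex hse (.bex hsc.symm
      (.and (isDelta0_oPairFml _ _ _) h))))
    have hfv : θ.fv ⊆ insert e (φ.fv \ {d, c}) := by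
      have h1 := fv_oPairFml e d c
      intro l hl
      simp only [θ, Fml.fv] at hl
      have h2 := @h1 l
      simp only [Set.mem_sdiff, Set.mem_union, Set.mem_insert_iff, Set.mem_singleton_iff] at hl h2 ⊢
      tauto
    have hsat : ∀ (N : Type) (E : N → N → Prop) v, Sat E v θ ↔
        ∃ y z, IsOPairOf E (v e) y z ∧ Sat E (update (update v d y) c z) φ := by
      intro N E v
      have key : ∀ (a y a' z : N), Sat E (update (update (update (update v s a) d y) s a') c z) φ ↔
          Sat E (update (update v d y) c z) φ := by
        intro a y a' z
        refine sat_congr fun l hl => ?_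
        have : l ≠ s := by rintro rfl; exact hs hl
        simp [update_apply, this]
      simp only [θ, sat_ex, sat_and, sat_mem, sat_oPairFml, key]
      simp only [update_self, update_of_ne hsd, update_of_ne hsc, update_of_ne hsd.symm,
        update_of_ne hse.symm, update_of_ne hed, update_of_ne hec, update_of_ne hdc]
      constructor
      · rintro ⟨a, -, y, -, a', -, z, -, hp, hφ⟩
        exact ⟨y, z, hp, hφ⟩
      · rintro ⟨y, z, hp, hφ⟩
        obtain ⟨s', t', h1, h2, h3⟩ := id hp
        exact ⟨s', (h3 _).2 (.inl rfl), y, (h1 _).2 (.inl rfl), t', (h3 _).2 (.inr rfl), z,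
          (h2 _).2 (.inr rfl), hp, hφ⟩
    have hsat' : ∀ (N : Type) (E : N → N → Prop) v, Sat E v (θ.ren (update id e c)) ↔
        ∃ y z, IsOPairOf E (v c) y z ∧ Sat E (update (update v d y) c z) φ := by
      intro N E v
      rw [sat_ren, hsat]
      refine exists₂_congr fun y z => and_congr (by simp) (sat_congr fun l hl => ?_)
      have : l ≠ e := by rintro rfl; exact he hl
      simp [update_apply, this]
    refine ⟨θ.ren (update id e c), hθ.ren _, ?_, fun N E v => ⟨fun y z hyz => ?_, fun hv => ?_⟩⟩
    · refine (θ.fv_ren _).trans ?_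
      rintro _ ⟨l, hl, rfl⟩
      by_cases hle : l = e
      · simp [hle]
      · rcases hfv hl with rfl | hl
        · exact absurd rfl hle
        · simp only [Set.mem_sdiff, Set.mem_insert_iff, Set.mem_singleton_iff, not_or] at hl
          simp [hle, hl]
    · rw [hsat']
      constructor
      · rintro ⟨y', z', hp, hφ⟩
        obtain ⟨rfl, rfl⟩ := hyz.inj hp
        exact hφ
      · exact fun hφ => ⟨y, z, hyz, hφ⟩
    · obtain ⟨y, z, hp, -⟩ := (hsat' N E v).1 hv
      exact ⟨y, z, hp⟩
  | succ k ih =>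
    obtain ⟨i, ψ, hψ, rfl⟩ := h
    obtain ⟨j, hj⟩ : ∃ j, j ∉ ψ.fv ∪ {d, c} :=
      ⟨_, fresh_notMem (ψ.fv_finite.union (by simp))⟩
    simp only [Set.mem_union, Set.mem_insert_iff, Set.mem_singleton_iff, not_or, ← ne_eq] at hj
    obtain ⟨hj, hjd, hjc⟩ := hj
    obtain ⟨ψ', hψ', hfv, hs⟩ := ih (hψ.ren (update id i j))
    refine ⟨Fml.quant b j ψ', ⟨j, ψ', hψ', rfl⟩, ?_, fun N E v => ⟨fun y z hyz => ?_, fun hv => ?_⟩⟩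
    · rw [Fml.fv_quant, Fml.fv_quant]
      rintro l ⟨hl, hlj⟩
      rcases hfv hl with rfl | ⟨hl, hld⟩
      · exact .inl rfl
      · have := image_update_diff_subset id i j ψ.fv ⟨ψ.fv_ren _ hl, hlj⟩
        rw [Set.image_id] at this
        exact .inr ⟨this, hld⟩
    · rw [sat_quant, sat_quant]
      refine Quant.congr fun a => ?_
      rw [(hs N E _).1 y z (by simpa [update_of_ne hjc.symm] using hyz), sat_ren]
      refine sat_congr fun l hl => ?_
      have hlj : l ≠ j := by rintro rfl; exact hj hl
      by_cases hli : l = i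
      · simp [hli, update_of_ne hjd, update_of_ne hjc]
      · simp [update_apply, hli, hlj]
    · have : Nonempty N := ⟨v 0⟩
      rw [sat_quant] at hv
      obtain ⟨a, ha⟩ := hv.exists
      simpa [update_of_ne hjc.symm] using (hs N E _).2 ha

/-- All free variables outside `P` of a formula can be merged into the single variable `c`. -/
theorem Lev.exists_tuple {b : Bool} {k : ℕ} {φ : Fml} (h : Lev b k φ) {N : Type}
    {E : N → N → Prop} {S : Set N} (hS : ∀ x ∈ S, ∀ y ∈ S, ∃ z ∈ S, IsOPairOf E z x y)
    {P : Set ℕ} {c : ℕ} (hc : c ∉ P) (v : ℕ → N) (hv : ∀ k ∉ P, v k ∈ S) :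
    ∃ φ', Lev b k φ' ∧ φ'.fv ⊆ insert c P ∧ ∃ a ∈ S, ∀ u : ℕ → N, (∀ k ∉ P, u k = v k) →
      (Sat E u φ ↔ Sat E (update u c a) φ') := by
  suffices H : ∀ F : Set ℕ, F.Finite → ∀ φ, Lev b k φ → φ.fv ⊆ insert c P ∪ F →
      ∀ v : ℕ → N, (∀ k ∉ P, v k ∈ S) →
      ∃ φ', Lev b k φ' ∧ φ'.fv ⊆ insert c P ∧ ∃ a ∈ S, ∀ u : ℕ → N, (∀ k ∉ P, u k = v k) →
        (Sat E u φ ↔ Sat E (update u c a) φ') from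
    H φ.fv φ.fv_finite φ h Set.subset_union_right v hv
  intro F hF
  induction F, hF using Set.Finite.induction_on with
  | empty =>
    intro φ h hfv v hv
    refine ⟨φ, h, by simpa using hfv, v c, hv c hc, fun u hu => ?_⟩
    rw [← hu c hc, update_eq_self]
  | @insert d F _ _ ih =>
    intro φ h hfv v hv
    by_cases hd : d ∈ insert c P
    · refine ih φ h (hfv.trans ?_) v hv
      rintro l (hl | rfl | hl)
      exacts [.inl hl, .inl hd, .inr hl]
    · have hdc : d ≠ c := fun h => hd (.inl h)
      have hdP : d ∉ P := fun h => hd (.inr h)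
      obtain ⟨φ₁, h₁, hfv₁, hs₁⟩ := h.exists_pairing hdc
      obtain ⟨p, hpS, hp⟩ := hS _ (hv d hdP) _ (hv c hc)
      obtain ⟨φ', h', hfv', a, ha, hs'⟩ := ih φ₁ h₁ (by
        intro l hl
        rcases hfv₁ hl with rfl | ⟨hl, hld⟩
        · exact .inl (.inl rfl)
        · rcases hfv hl with hl | hl | hl
          exacts [.inl hl, absurd hl hld, .inr hl]) (update v c p) (by
        intro l hl
        by_cases hlc : l = c
        · simpa [hlc] using hpS
        · simpa [hlc] using hv l hl)
      refine ⟨φ', h', hfv', a, ha, fun u hu => ?_⟩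
      have := hs' (update u c p) (by
        intro l hl
        by_cases hlc : l = c
        · simp [hlc]
        · simpa [hlc] using hu l hl)
      rw [update_idem] at this
      rw [← this, (hs₁ N E _).1 (v d) (v c) (by simpa using hp)]
      refine sat_congr fun l _ => ?_
      by_cases hlc : l = c
      · simp [hlc, hu c hc]
      · by_cases hld : l = d
        · simp [hld, hdc, hu d hdP]
        · simp [hlc, hld]

/-- Variables `i`, `j` of a formula can be replaced by a single one, chosen fresh, standing for
the ordered pair of their values. -/
theorem Lev.exists_fresh_pairing {b : Bool} {k : ℕ} {ψ : Fml} (hψ : Lev b k ψ) (i j : ℕ) :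
    ∃ c ψ', Lev b k ψ' ∧ ∀ (N : Type) (E : N → N → Prop) v p,
      (∀ y z, IsOPairOf E p y z →
        (Sat E (update v c p) ψ' ↔ Sat E (update (update v i y) j z) ψ)) ∧
      (Sat E (update v c p) ψ' → ∃ y z, IsOPairOf E p y z) := by
  obtain ⟨c, hc⟩ : ∃ c, c ∉ ψ.fv ∪ {i} := ⟨_, fresh_notMem (ψ.fv_finite.union (by simp))⟩
  simp only [Set.mem_union, Set.mem_singleton_iff, not_or] at hc
  obtain ⟨ψ', hψ', -, hs⟩ := Lev.exists_pairing (hψ.ren (update id j c)) (Ne.symm hc.2)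
  refine ⟨c, ψ', hψ', fun N E v p => ⟨fun y z hp => ?_, fun h => by simpa using (hs N E _).2 h⟩⟩
  rw [(hs N E _).1 y z (by simpa using hp), sat_ren]
  refine sat_congr fun l hl => ?_
  have hlc : l ≠ c := by rintro rfl; exact hc.1 hl
  by_cases hlj : l = j
  · simp [hlj]
  · simp [update_apply, hlj, hlc]

/-- Consecutive existential quantifiers can be contracted. -/
theorem Lev.exists_ex {k : ℕ} {φ : Fml} (h : Lev true (k + 1) φ) (i : ℕ) :
    ∃ φ', Lev true (k + 1) φ' ∧
      ∀ (N : Type) (E : N → N → Prop), SatDB0 E → ∀ v, Sat E v φ' ↔ Sat E v (.ex i φ) := by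
  obtain ⟨j, ψ, hψ, rfl⟩ := h
  obtain ⟨c, ψ', hψ', hs⟩ := hψ.exists_fresh_pairing i j
  refine ⟨.ex c ψ', ⟨c, ψ', hψ', rfl⟩, fun N E hE v => ?_⟩
  simp only [sat_ex, Fml.quant]
  constructor
  · rintro ⟨p, hp⟩
    obtain ⟨y, z, hyz⟩ := (hs N E v p).2 hp
    exact ⟨y, z, ((hs N E v p).1 y z hyz).1 hp⟩
  · rintro ⟨y, z, h⟩
    obtain ⟨p, hp⟩ := hE.exists_oPair y z
    exact ⟨p, ((hs N E v p).1 y z hp).2 h⟩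

end FOSet

namespace FOSet

open Function

/-! ### Separation and strong collection with arbitrary parameters -/

/-- Separation for `φ` with arbitrary parameters. -/
def SepFor {M : Type} (E : M → M → Prop) (φ : Fml) : Prop :=
  ∀ (v : ℕ → M) (i : ℕ) (p : M), ∃ q, ∀ x, E x q ↔ (E x p ∧ Sat E (update v i x) φ)

/-- Strong collection for `φ` with arbitrary parameters. -/
def CollSFor {M : Type} (E : M → M → Prop) (φ : Fml) : Prop :=
  ∀ (v : ℕ → M) (i j : ℕ) (p : M), i ≠ j → ∃ q, ∀ x, E x p → ∀ y,
    Sat E (update (update v i x) j y) φ →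
      ∃ y', E y' q ∧ Sat E (update (update v i x) j y') φ

section Schemes

variable {M : Type} {E : M → M → Prop} {n k : ℕ} {φ : Fml}

theorem SatDB0.sepFor (hE : SatDB0 E) (hφ : IsDelta0 φ) : SepFor E φ := by
  intro v i p
  let ρ : ℕ → ℕ := fun k => if k = i then 0 else k + 2
  obtain ⟨φ', h', hfv, a, -, hs⟩ := Lev.exists_tuple (b := true) (k := 0) (hφ.ren ρ)
    (S := Set.univ) (E := E) (fun x _ y _ => by simpa using hE.exists_oPair x y)
    (P := {0}) (c := 1) (by simp) (fun k => v (k - 2)) (by simp)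
  obtain ⟨q, hq⟩ := hE.2.2.2.2.2 φ' h' (fun l hl => by simpa [or_comm] using hfv hl) a p
  refine ⟨q, fun x => (hq x).trans (and_congr_right fun _ => ?_)⟩
  rw [sat_congr (w := update (update (fun k => v (k - 2)) 0 x) 1 a),
    ← hs _ (by intro k hk; simp only [Set.mem_singleton_iff] at hk; simp [hk]), sat_ren]
  · refine sat_congr fun l _ => ?_
    by_cases hl : l = i <;> simp [ρ, hl]
  · intro l hl
    rcases hfv hl with rfl | rfl <;> simp [val2]

theorem CollSScheme.collSFor (hE : SatDB0 E) (h : CollSScheme E (IsSigma n))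
    (hφ : Lev true n φ) : CollSFor E φ := by
  intro v i j p hij
  let ρ : ℕ → ℕ := fun k => if k = i then 0 else if k = j then 1 else k + 3
  obtain ⟨φ', h', hfv, a, -, hs⟩ := Lev.exists_tuple (hφ.ren ρ)
    (S := Set.univ) (E := E) (fun x _ y _ => by simpa using hE.exists_oPair x y)
    (P := {0, 1}) (c := 2) (by simp) (fun k => v (k - 3)) (by simp)
  obtain ⟨q, hq⟩ := h φ' (by rwa [isSigma_eq_lev])
    (fun l hl => by have := hfv hl; simp at this ⊢; tauto) a p
  have key : ∀ x y, Sat E (val3 x y a) φ' ↔ Sat E (update (update v i x) j y) φ := by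
    intro x y
    rw [sat_congr (w := update (update (update (fun k => v (k - 3)) 0 x) 1 y) 2 a),
      ← hs _ (by intro k hk; simp at hk; simp [hk]), sat_ren]
    · refine sat_congr fun l _ => ?_
      by_cases hl : l = i
      · simp [ρ, hl, hij]
      · by_cases hl' : l = j <;> simp [ρ, hl, hl', hij.symm]
    · intro l hl
      rcases hfv hl with rfl | rfl | rfl <;> simp [val3]
  simp only [key] at hq
  exact ⟨q, fun x hx y hy => (hq x hx).1 ⟨y, hy⟩⟩

theorem SepFor.congr {ψ : Fml} (h : SepFor E φ) (hs : ∀ v, Sat E v ψ ↔ Sat E v φ) :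
    SepFor E ψ := by
  simpa only [SepFor, hs] using h

theorem CollSFor.congr {ψ : Fml} (h : CollSFor E φ) (hs : ∀ v, Sat E v ψ ↔ Sat E v φ) :
    CollSFor E ψ := by
  simpa only [CollSFor, hs] using h

theorem SepFor.not (hE : SatDB0 E) (h : SepFor E φ) : SepFor E φ.not := by
  intro v i p
  obtain ⟨q, hq⟩ := h v i p
  obtain ⟨r, hr⟩ := hE.sepFor (φ := (Fml.mem 0 1).not) (.not (.mem _ _)) (fun _ => q) 0 p
  refine ⟨r, fun x => ?_⟩
  rw [hr]
  simp only [sat_not, sat_mem, update_self, ne_eq, one_ne_zero, not_false_eq_true, update_of_ne, hq]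
  tauto

theorem CollSScheme.collSFor_of_lev (hE : SatDB0 E) (h : CollSScheme E (IsSigma (n + 1)))
    (hkn : k ≤ n) (hφ : Lev false k φ) : CollSFor E φ := by
  obtain ⟨φ₁, h₁, -, hs₁⟩ := hφ.exists_le hkn
  obtain ⟨φ₂, h₂, -, hs₂⟩ := h₁.exists_quant true (.inl rfl)
  exact (h.collSFor hE h₂).congr fun v => ((hs₂ M E v).trans (hs₁ M E v)).symm

/-- Strong `Σ_{n+1}`-collection implies `Σ_{n+1}`-separation. -/
theorem CollSScheme.sepFor (hE : SatDB0 E) (h : CollSScheme E (IsSigma (n + 1)))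
    (hkn : k ≤ n + 1) (hφ : Lev true k φ) : SepFor E φ := by
  induction k generalizing φ with
  | zero => exact hE.sepFor hφ
  | succ k ih =>
    obtain ⟨l, ψ, hψ, rfl⟩ := hφ
    intro v i p
    obtain ⟨j, hj⟩ : ∃ j, j ∉ ψ.fv ∪ {i} := ⟨_, fresh_notMem (ψ.fv_finite.union (by simp))⟩
    simp only [Set.mem_union, Set.mem_singleton_iff, not_or, ← ne_eq] at hj
    obtain ⟨hjψ, hji⟩ := hj
    have hπ : Lev false k (ψ.ren (update id l j)) := hψ.ren _
    set π := ψ.ren (update id l j) with hπdef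
    have hex : ∀ x, Sat E (update v i x) (Fml.quant true l ψ) ↔
        ∃ y, Sat E (update (update v i x) j y) π := by
      intro x
      rw [Fml.quant, sat_ex]
      refine exists_congr fun y => ?_
      rw [hπdef, sat_ren]
      refine sat_congr fun m hm => ?_
      have hmj : m ≠ j := by rintro rfl; exact hjψ hm
      by_cases hml : m = l
      · simp [hml]
      · simp [update_apply, hml, hmj]
    obtain ⟨q, hq⟩ := h.collSFor_of_lev hE (Nat.le_of_succ_le_succ hkn) hπ v i j p hji.symm
    obtain ⟨π', hπ', -, hs⟩ := hπ.exists_pairing hji.symm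
    obtain ⟨r, hr⟩ := hE.2.2.2.2.1 p q
    have hsep : SepFor E π' := by
      obtain ⟨π'', h'', hs''⟩ := hπ'.exists_neg
      refine ((ih (by omega) h'').not hE).congr fun w => ?_
      exact iff_not_comm.1 (hs'' M E Set.univ w)
    obtain ⟨s, hs'⟩ := hsep v j r
    obtain ⟨t, ht⟩ := hE.sepFor (φ := .ex 1 ((Fml.mem 1 2).and (.ex 3 ((Fml.mem 3 4).and
      (oPairFml 3 0 1))))) (.bex (by decide) (.bex (by decide) (isDelta0_oPairFml _ _ _)))
      (fun m => if m = 2 then q else s) 0 p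
    refine ⟨t, fun x => (ht x).trans (and_congr_right fun hx => ?_)⟩
    rw [hex]
    simp only [sat_ex, sat_and, sat_mem, sat_oPairFml, update_apply]
    simp only [OfNat.ofNat_ne_zero, OfNat.zero_ne_ofNat, OfNat.one_ne_ofNat, OfNat.ofNat_ne_one,
      Nat.reduceEqDiff, zero_ne_one, one_ne_zero, reduceIte]
    have key : ∀ y z, IsOPairOf E z x y →
        (Sat E (update v j z) π' ↔ Sat E (update (update v i x) j y) π) := by
      intro y z hz
      rw [(hs M E _).1 x y (by simpa using hz)]
      rw [update_comm hji, update_idem]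
    constructor
    · rintro ⟨y, -, z, hz, hp⟩
      exact ⟨y, (key y z hp).1 ((hs' z).1 hz).2⟩
    · rintro ⟨y, hy⟩
      obtain ⟨y', hy', hyπ⟩ := hq x hx y hy
      obtain ⟨z, hz⟩ := hE.exists_oPair x y'
      exact ⟨y', hy', z, (hs' z).2 ⟨(hr z).2 ⟨x, y', hx, hy', hz⟩, (key y' z hz).2 hyπ⟩, hz⟩

end Schemes

/-! ### Elementary embeddings and hulls -/

section Embeddings

variable {M N : Type} {EM : M → M → Prop} {EN : N → N → Prop} {f : M → N} {n : ℕ} {φ : Fml}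

theorem SigmaElemEmb.sat_iff (hf : SigmaElemEmb n EM EN f) {k : ℕ} (hkn : k ≤ n)
    (hφ : Lev true k φ) (v : ℕ → M) : Sat EM v φ ↔ Sat EN (f ∘ v) φ := by
  obtain ⟨φ', h', -, hs⟩ := hφ.exists_le hkn
  rw [← hs, ← hs]
  exact hf φ' (by rwa [isSigma_eq_lev]) v

theorem SigmaElemEmb.delta0 (hf : SigmaElemEmb n EM EN f) : Delta0ElemEmb EM EN f :=
  fun _ hφ v => hf.sat_iff (Nat.zero_le n) hφ v

theorem Delta0ElemEmb.mem_iff (hf : Delta0ElemEmb EM EN f) (a b : M) :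
    EM a b ↔ EN (f a) (f b) := by
  simpa using hf (.mem 0 1) (.mem _ _) (fun k => if k = 0 then a else b)

theorem Delta0ElemEmb.map_mem_hull (hf : Delta0ElemEmb EM EN f) (hM : SatDB0 EM) (m : M) :
    f m ∈ hull EN f := by
  obtain ⟨p, hp⟩ := hM.2.2.1 m m
  exact ⟨p, (hf.mem_iff _ _).1 ((hp m).2 (.inl rfl))⟩

theorem Delta0ElemEmb.mem_hull_trans (hf : Delta0ElemEmb EM EN f) (hM : SatDB0 EM) {a b : N}
    (ha : a ∈ hull EN f) (hb : EN b a) : b ∈ hull EN f := by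
  obtain ⟨m, hm⟩ := ha
  obtain ⟨u, hu⟩ := hM.2.2.2.1 m
  have := hf (.all 0 ((Fml.mem 0 1).imp (.all 2 ((Fml.mem 2 0).imp (.mem 2 3)))))
    (.ball (by decide) (.ball (by decide) (.mem _ _))) (fun k => if k = 1 then m else u)
  simp only [sat_all, sat_imp, sat_mem, update_apply, comp_apply] at this
  simp only [OfNat.zero_ne_ofNat, OfNat.ofNat_ne_zero, OfNat.ofNat_ne_one,
    Nat.reduceEqDiff, one_ne_zero, reduceIte] at this
  exact ⟨u, this.1 (fun x hx y hy => (hu y).2 ⟨x, hx, hy⟩) a hm b hb⟩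

theorem Delta0ElemEmb.exists_oPair_hull (hf : Delta0ElemEmb EM EN f) (hM : SatDB0 EM) :
    ∀ a ∈ hull EN f, ∀ b ∈ hull EN f, ∃ p ∈ hull EN f, IsOPairOf EN p a b := by
  rintro a ⟨m, hm⟩ b ⟨m', hm'⟩
  obtain ⟨r, hr⟩ := hM.2.2.2.2.1 m m'
  have := hf (.all 0 ((Fml.mem 0 1).imp (.all 2 ((Fml.mem 2 3).imp
    (.ex 4 ((Fml.mem 4 5).and (oPairFml 4 0 2)))))))
    (.ball (by decide) (.ball (by decide) (.bex (by decide) (isDelta0_oPairFml _ _ _))))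
    (fun k => if k = 1 then m else if k = 3 then m' else r)
  simp only [sat_all, sat_imp, sat_mem, sat_ex, sat_and, sat_oPairFml, update_apply,
    comp_apply] at this
  simp only [OfNat.zero_ne_ofNat, OfNat.one_ne_ofNat, OfNat.ofNat_ne_zero, OfNat.ofNat_ne_one,
    Nat.reduceEqDiff, one_ne_zero, reduceIte] at this
  obtain ⟨p, hp, hp'⟩ := this.1 (fun x hx y hy => by
    obtain ⟨z, hz⟩ := hM.exists_oPair x y
    exact ⟨z, (hr z).2 ⟨x, y, hx, hy, hz⟩, hz⟩) a hm b hm'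
  exact ⟨p, ⟨r, hp⟩, hp'⟩

/-- `Δ₀` formulas are absolute for transitive substructures. -/
theorem IsDelta0.satIn_iff {S : Set N} (hS : ∀ a ∈ S, ∀ b, EN b a → b ∈ S) (hφ : IsDelta0 φ)
    (v : ℕ → N) (hv : ∀ k, v k ∈ S) : SatIn EN S v φ ↔ Sat EN v φ := by
  have hup : ∀ (v : ℕ → N), (∀ k, v k ∈ S) → ∀ i, ∀ a ∈ S, ∀ k, update v i a k ∈ S := by
    intro v hv i a ha k
    by_cases hk : k = i
    · simpa [hk] using ha
    · simpa [hk] using hv k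
  induction hφ generalizing v with
  | mem i j => rfl
  | eq i j => rfl
  | not _ h => exact not_congr (h v hv)
  | and _ _ h h' => exact and_congr (h v hv) (h' v hv)
  | or _ _ h h' => exact or_congr (h v hv) (h' v hv)
  | imp _ _ h h' => exact imp_congr (h v hv) (h' v hv)
  | @ball i j φ hij _ h =>
    simp only [sat_all, sat_imp, sat_mem, SatIn, update_self, update_of_ne hij.symm]
    constructor
    · intro H a ha
      have haS := hS _ (hv j) _ ha
      exact (h _ (hup v hv i a haS)).1 (H a haS ha)
    · intro H a haS ha
      exact (h _ (hup v hv i a haS)).2 (H a ha)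
  | @bex i j φ hij _ h =>
    simp only [sat_ex, sat_and, sat_mem, SatIn, update_self, update_of_ne hij.symm]
    constructor
    · rintro ⟨a, haS, ha, H⟩
      exact ⟨a, ha, (h _ (hup v hv i a haS)).1 H⟩
    · rintro ⟨a, ha, H⟩
      have haS := hS _ (hv j) _ ha
      exact ⟨a, haS, ha, (h _ (hup v hv i a haS)).2 H⟩

/-- The Tarski–Vaught property of the hull for `Π_n` formulas. -/
theorem CollSScheme.exists_mem_hull (hM : SatDB0 EM) (hN : SatDB0 EN)
    (hC : CollSScheme EM (IsSigma (n + 1))) (hf : SigmaElemEmb (n + 1) EM EN f) {ψ : Fml}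
    (hψ : Lev false n ψ) {v : ℕ → N} (hv : ∀ k, v k ∈ hull EN f) {i : ℕ} {a : N}
    (ha : Sat EN (update v i a) ψ) : ∃ a' ∈ hull EN f, Sat EN (update v i a') ψ := by
  obtain ⟨φ, hφ, hfv, a₀, ⟨m, hm⟩, hs⟩ := hψ.exists_tuple (hf.delta0.exists_oPair_hull hM)
    (P := {i}) (c := i + 1) (by simp) v (fun k _ => hv k)
  have hs' : ∀ y, Sat EN (update v i y) ψ ↔ Sat EN (update (update v i y) (i + 1) a₀) φ :=
    fun y => hs _ fun k hk => update_of_ne hk _ _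
  have hφc : ∀ {N : Type} {E : N → N → Prop} {u u' : ℕ → N}, u i = u' i → u (i + 1) = u' (i + 1) →
      (Sat E u φ ↔ Sat E u' φ) := by
    intro N E u u' h h'
    refine sat_congr fun l hl => ?_
    rcases hfv hl with rfl | rfl
    exacts [h', h]
  obtain ⟨q, hq⟩ := hC.collSFor_of_lev hM le_rfl hφ (fun _ => m) (i + 1) i m (by simp)
  obtain ⟨π, hπ, hπfv, hπs⟩ := hφ.exists_pairing (d := i + 1) (c := i) (by simp)
  have hπc : ∀ {N : Type} {E : N → N → Prop} {u u' : ℕ → N}, u i = u' i →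
      (Sat E u π ↔ Sat E u' π) := by
    intro N E u u' h
    refine sat_congr fun l hl => ?_
    rcases hπfv hl with rfl | ⟨hl, hl'⟩
    · exact h
    · rcases hfv hl with rfl | rfl
      exacts [absurd rfl hl', h]
  obtain ⟨π', hπ', hπs'⟩ := hπ.exists_neg
  obtain ⟨r, hr⟩ := hM.2.2.2.2.1 m q
  obtain ⟨s, hsep⟩ : ∃ s, ∀ x, EM x s ↔ (EM x r ∧ Sat EM (update (fun _ => m) i x) π) := by
    have := (hC.sepFor hM (Nat.le_succ n) hπ').not hM
    exact this.congr (fun w => iff_not_comm.1 (hπs' M EM Set.univ w)) _ i r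
  let w : ℕ → M := fun k => if k = i + 2 then s else if k = i + 3 then m else q
  have hA : ∀ z, EN z (f s) → ∀ u : ℕ → N, u i = z → Sat EN u π := by
    obtain ⟨θ, hθ, hθs⟩ := hπ'.exists_and (IsDelta0.mem i (i + 2))
    obtain ⟨θ₁, hθ₁, -, hθs₁⟩ := hθ.exists_succ
    obtain ⟨θ₂, hθ₂, hθs₂⟩ := hθ₁.exists_ex i
    have key := hf.sat_iff le_rfl hθ₂ w
    rw [hθs₂ M EM hM, hθs₂ N EN hN] at key
    simp only [sat_ex, hθs₁, hθs] at key
    have h1 : ∀ z, Sat EM (update w i z) π' ↔ ¬ Sat EM (update (fun _ => m) i z) π := fun z => by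
      rw [hπc (u' := update w i z) (by simp)]
      exact hπs' M EM Set.univ _
    have hnot : ¬ ∃ z, Sat EM (update w i z) (.mem i (i + 2)) ∧ Sat EM (update w i z) π' := by
      rintro ⟨z, hz, hz'⟩
      rw [h1] at hz'
      refine hz' ((hsep z).1 ?_).2
      simpa [w] using hz
    rw [key] at hnot
    intro z hz u hu
    by_contra hcon
    refine hnot ⟨z, by simpa [w] using hz, (hπs' N EN Set.univ _).2 fun h => hcon ?_⟩
    exact (hπc (by simp [hu])).1 h
  let δ : Fml := (Fml.mem (i + 1) (i + 3)).and (.not (.ex (i + 5) ((Fml.mem (i + 5) (i + 2)).and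
    (.ex (i + 6) ((Fml.mem (i + 6) (i + 4)).and (oPairFml (i + 5) (i + 1) (i + 6)))))))
  have hδ : IsDelta0 δ := .and (.mem _ _) (.not (.bex (by simp) (.bex (by simp)
    (isDelta0_oPairFml _ _ _))))
  have hB : ∀ x y, EN x (f m) → (∀ u : ℕ → N, u (i + 1) = x → u i = y → Sat EN u φ) →
      ∃ z y', EN z (f s) ∧ EN y' (f q) ∧ IsOPairOf EN z x y' := by
    obtain ⟨θ, hθ, hθs⟩ := hφ.exists_and hδ
    obtain ⟨θ₁, hθ₁, hθs₁⟩ := Lev.exists_ex (k := n) (φ := .ex i θ) ⟨i, θ, hθ, rfl⟩ (i + 1)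
    have key := hf.sat_iff le_rfl hθ₁ w
    rw [hθs₁ M EM hM, hθs₁ N EN hN] at key
    simp only [sat_ex, hθs] at key
    have hnot : ¬ ∃ x y, Sat EM (update (update w (i + 1) x) i y) δ ∧
        Sat EM (update (update w (i + 1) x) i y) φ := by
      rintro ⟨x, y, ⟨hx, hxy⟩, hφ⟩
      have hx : EM x m := by simpa [w] using sat_mem.1 hx
      rw [hφc (u' := update (update (fun _ => m) (i + 1) x) i y) (by simp) (by simp)] at hφ
      obtain ⟨y', hy', hφ'⟩ := hq x hx y hφ
      obtain ⟨z, hz⟩ := hM.exists_oPair x y'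
      refine hxy ?_
      have hzs : EM z s := by
        refine (hsep z).2 ⟨(hr z).2 ⟨x, y', hx, hy', hz⟩, ?_⟩
        rw [(hπs M EM _).1 x y' (by simpa using hz)]
        exact (hφc (by simp) (by simp)).1 hφ'
      refine sat_ex.2 ⟨z, sat_mem.2 (by simpa [w] using hzs), sat_ex.2 ⟨y', sat_mem.2 ?_, ?_⟩⟩
      · simpa [w] using hy'
      · exact sat_oPairFml.2 (by simpa using hz)
    rw [key] at hnot
    intro x y hx hxy
    by_contra hcon
    refine hnot ⟨x, y, ⟨sat_mem.2 (by simpa [w] using hx), fun h => hcon ?_⟩, hxy _ (by simp) (by simp)⟩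
    obtain ⟨z, hz, h⟩ := sat_ex.1 h
    obtain ⟨y', hy', h⟩ := sat_ex.1 h
    exact ⟨z, y', by simpa [w] using sat_mem.1 hz, by simpa [w] using sat_mem.1 hy', by
      simpa using sat_oPairFml.1 h⟩
  obtain ⟨z, y', hz, hy', hp⟩ := hB a₀ a hm fun u h h' =>
    (hφc (by simp [h']) (by simp [h])).1 ((hs' a).1 ha)
  refine ⟨y', ⟨q, hy'⟩, (hs' y').2 ?_⟩
  have := ((hπs N EN (update v i z)).1 a₀ y' (by simpa using hp)).1 (hA z hz _ (by simp))
  exact (hφc (by simp) (by simp)).1 this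

theorem CollSScheme.sigmaElemInTop (hM : SatDB0 EM) (hN : SatDB0 EN)
    (hC : CollSScheme EM (IsSigma (n + 1))) (hf : SigmaElemEmb (n + 1) EM EN f) :
    SigmaElemInTop (n + 1) EN (hull EN f) := by
  suffices H : ∀ k ≤ n + 1, ∀ b φ, Lev b k φ → ∀ v : ℕ → N, (∀ k, v k ∈ hull EN f) →
      (SatIn EN (hull EN f) v φ ↔ Sat EN v φ) by
    intro φ hφ v hv
    rw [isSigma_eq_lev] at hφ
    exact H _ le_rfl _ φ hφ v hv
  intro k
  induction k with
  | zero =>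
    intro _ b φ hφ v hv
    exact IsDelta0.satIn_iff (fun a ha b hb => hf.delta0.mem_hull_trans hM ha hb) hφ v hv
  | succ k ih =>
    rintro hk b _ ⟨i, ψ, hψ, rfl⟩ v hv
    have ih' : ∀ a ∈ hull EN f, (SatIn EN (hull EN f) (update v i a) ψ ↔
        Sat EN (update v i a) ψ) := fun a ha => ih (by omega) _ ψ hψ _ (by
      intro l
      by_cases hl : l = i
      · simpa [hl] using ha
      · simpa [hl] using hv l)
    cases b
    · simp only [Fml.quant, sat_all, SatIn]
      refine ⟨fun H a => ?_, fun H a ha => (ih' a ha).2 (H a)⟩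
      by_contra hcon
      obtain ⟨ψ', hψ', hs⟩ := hψ.exists_neg
      obtain ⟨ψ'', hψ'', -, hs'⟩ := hψ'.exists_le (n := n) (by omega)
      obtain ⟨a', ha', h⟩ := hC.exists_mem_hull hM hN hf hψ'' hv
        ((hs' N EN _).2 ((hs N EN Set.univ _).2 hcon))
      exact (hs N EN Set.univ _).1 ((hs' N EN _).1 h) ((ih' a' ha').1 (H a' ha'))
    · simp only [Fml.quant, sat_ex, SatIn]
      constructor
      · rintro ⟨a, ha, h⟩
        exact ⟨a, (ih' a ha).1 h⟩
      · rintro ⟨a, ha⟩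
        obtain ⟨ψ', hψ', -, hs⟩ := hψ.exists_le (n := n) (by omega)
        obtain ⟨a', ha', h⟩ := hC.exists_mem_hull hM hN hf hψ' hv ((hs N EN _).2 ha)
        exact ⟨a', ha', (ih' a' ha').2 ((hs N EN _).1 h)⟩

end Embeddings

end FOSet

namespace FOSet

open Function Filter

/-! ### Axioms as sentences, and their preservation under elementary embeddings -/

/-- A property of structures is elementary if it is expressed by a sentence. -/
def IsElementary (P : ∀ N : Type, (N → N → Prop) → Prop) : Prop :=
  ∃ φ : Fml, ∀ (N : Type) (E : N → N → Prop) v, Sat E v φ ↔ P N E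

theorem IsElementary.iff {P : ∀ N : Type, (N → N → Prop) → Prop} (hP : IsElementary P)
    {M N : Type} [hne : Nonempty M] {EM : M → M → Prop} {EN : N → N → Prop} {f : M → N}
    (hf : ElemEmb EM EN f) : P M EM ↔ P N EN := by
  obtain ⟨φ, h⟩ := hP
  rw [← h M EM fun _ => hne.some, hf, h]

/-- The biconditional of two formulas. -/
def Fml.biimp (φ ψ : Fml) : Fml := (φ.imp ψ).and (ψ.imp φ)

@[simp] theorem sat_biimp {N : Type} {E : N → N → Prop} {v : ℕ → N} {φ ψ : Fml} :
    Sat E v (φ.biimp ψ) ↔ (Sat E v φ ↔ Sat E v ψ) := by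
  simp only [Fml.biimp, sat_and, sat_imp, iff_def]

theorem isElementary_sepAx {φ : Fml} (hφ : φ.fv ⊆ {0, 1}) :
    IsElementary fun _ E => SepAx E φ := by
  refine ⟨.all 1 (.all 2 (.ex 3 (.all 0 ((Fml.mem 0 3).biimp ((Fml.mem 0 2).and φ))))),
    fun N E v => ?_⟩
  simp only [SepAx, sat_all, sat_ex, sat_biimp, sat_and, sat_mem]
  refine forall₂_congr fun a p => exists_congr fun q => forall_congr' fun x =>
    iff_congr (by simp) (and_congr (by simp) (sat_congr fun k hk => ?_))
  rcases hφ hk with rfl | rfl <;> simp [val2]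

theorem isElementary_collAx {φ : Fml} (hφ : φ.fv ⊆ {0, 1, 2}) :
    IsElementary fun _ E => CollAx E φ := by
  refine ⟨.all 2 (.all 3 ((Fml.all 0 ((Fml.mem 0 3).imp (.ex 1 φ))).imp
    (.ex 4 (.all 0 ((Fml.mem 0 3).imp (.ex 1 ((Fml.mem 1 4).and φ))))))), fun N E v => ?_⟩
  simp only [CollAx, sat_all, sat_ex, sat_imp, sat_and, sat_mem]
  refine forall₂_congr fun a p => imp_congr
    (forall_congr' fun x => imp_congr (by simp) (exists_congr fun y => sat_congr fun k hk => ?_))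
    (exists_congr fun q => forall_congr' fun x => imp_congr (by simp)
      (exists_congr fun y => and_congr (by simp) (sat_congr fun k hk => ?_))) <;>
  rcases hφ hk with rfl | rfl | rfl <;> simp [val3]

theorem ElemEmb.satDB0 {M N : Type} {EM : M → M → Prop} {EN : N → N → Prop} {f : M → N}
    (hf : ElemEmb EM EN f) (hM : SatDB0 EM) : SatDB0 EN := by
  obtain ⟨hext, hemp, hpair, hunion, hprod, hsep⟩ := hM
  have : Nonempty M := hemp.nonempty
  refine ⟨(IsElementary.iff (P := fun N E => ∀ a b : N, (∀ x, E x a ↔ E x b) → a = b) ?_ hf).1 hext,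
    (IsElementary.iff (P := fun N E => ∃ e : N, ∀ x, ¬ E x e) ?_ hf).1 hemp,
    (IsElementary.iff (P := fun N E => ∀ a b : N, ∃ p, IsPairOf E p a b) ?_ hf).1 hpair,
    (IsElementary.iff (P := fun N E => ∀ a : N, ∃ u, ∀ x, E x u ↔ ∃ y, E y a ∧ E x y) ?_ hf).1
      hunion,
    (IsElementary.iff (P := fun N E => ∀ a b : N, ∃ c, ∀ z, E z c ↔
      ∃ x y, E x a ∧ E y b ∧ IsOPairOf E z x y) ?_ hf).1 hprod,
    fun φ hφ hfv => ((isElementary_sepAx hfv).iff hf).1 (hsep φ hφ hfv)⟩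
  · exact ⟨.all 0 (.all 1 ((Fml.all 2 ((Fml.mem 2 0).biimp (.mem 2 1))).imp (.eq 0 1))),
      fun N E v => by simp⟩
  · exact ⟨.ex 0 (.all 1 (.not (.mem 1 0))), fun N E v => by simp⟩
  · exact ⟨.all 0 (.all 1 (.ex 2 (.all 3 ((Fml.mem 3 2).biimp ((Fml.eq 3 0).or (.eq 3 1)))))),
      fun N E v => by simp [IsPairOf]⟩
  · exact ⟨.all 0 (.ex 1 (.all 2 ((Fml.mem 2 1).biimp
      (.ex 3 ((Fml.mem 3 0).and (.mem 2 3)))))), fun N E v => by simp⟩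
  · exact ⟨.all 0 (.all 1 (.ex 2 (.all 3 ((Fml.mem 3 2).biimp (.ex 4 (.ex 5 ((Fml.mem 4 0).and
      ((Fml.mem 5 1).and (oPairFml 3 4 5))))))))), fun N E v => by simp⟩

theorem ElemEmb.collScheme {M N : Type} {EM : M → M → Prop} {EN : N → N → Prop} {f : M → N}
    [Nonempty M] (hf : ElemEmb EM EN f) {Γ : Fml → Prop} (h : CollScheme EM Γ) :
    CollScheme EN Γ :=
  fun φ hφ hfv => ((isElementary_collAx hfv).iff hf).1 (h φ hφ hfv)

theorem ElemEmb.sigmaElemEmb {M N : Type} {EM : M → M → Prop} {EN : N → N → Prop} {f : M → N}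
    (hf : ElemEmb EM EN f) (n : ℕ) : SigmaElemEmb n EM EN f :=
  fun φ _ v => hf φ v

theorem ElemEmb.subStr {M N : Type} {EM : M → M → Prop} {EN : N → N → Prop} {f : M → N}
    (hf : ElemEmb EM EN f) : SubStr EM EN f := by
  refine ⟨fun a b hab => ?_, fun a b => ?_⟩
  · simpa [hab] using hf (.eq 0 1) (fun k => if k = 0 then a else b)
  · simpa using hf (.mem 0 1) (fun k => if k = 0 then a else b)

/-! ### Ultrapowers -/

theorem update_germ {I M : Type} (l : Filter I) (g : ℕ → I → M) (j : ℕ) (h : I → M) :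
    update (fun k => (g k : l.Germ M)) j h = fun k => ((update g j h k : I → M) : l.Germ M) := by
  funext k
  by_cases hk : k = j
  · subst hk; simp
  · simp [hk]

theorem update_swap_apply {I M : Type} (g : ℕ → I → M) (j : ℕ) (h : I → M) (i : I) :
    (fun k => update g j h k i) = update (fun k => g k i) j (h i) := by
  funext k
  by_cases hk : k = j
  · subst hk; simp
  · simp [hk]

/-- Łoś's theorem for ultrapowers. -/
theorem sat_germ {I M : Type} (U : Ultrafilter I) (E : M → M → Prop) (φ : Fml)
    (g : ℕ → I → M) :
    Sat (Germ.LiftRel E) (fun k => (g k : (U : Filter I).Germ M)) φ ↔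
      ∀ᶠ i in U, Sat E (fun k => g k i) φ := by
  have hex : ∀ (φ : Fml) (g : ℕ → I → M) (j : ℕ),
      (∃ h : I → M, ∀ᶠ i in U, Sat E (update (fun k => g k i) j (h i)) φ) ↔
        ∀ᶠ i in U, ∃ a, Sat E (update (fun k => g k i) j a) φ := by
    intro φ g j
    constructor
    · rintro ⟨h, hh⟩
      exact hh.mono fun i hi => ⟨_, hi⟩
    · intro H
      have : ∀ i, ∃ a, (∃ a, Sat E (update (fun k => g k i) j a) φ) →
          Sat E (update (fun k => g k i) j a) φ := by
        intro i
        by_cases hi : ∃ a, Sat E (update (fun k => g k i) j a) φ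
        · exact ⟨hi.choose, fun _ => hi.choose_spec⟩
        · exact ⟨g 0 i, fun h => absurd h hi⟩
      choose h hh using this
      exact ⟨h, H.mono hh⟩
  induction φ generalizing g with
  | mem i j => exact Germ.liftRel_coe
  | eq i j => exact Germ.coe_eq
  | not φ ih => simp only [sat_not, ih, Ultrafilter.eventually_not]
  | and φ ψ h h' => simp only [sat_and, h, h', eventually_and]
  | or φ ψ h h' => simp only [sat_or, h, h', Ultrafilter.eventually_or]
  | imp φ ψ h h' => simp only [sat_imp, h, h', Ultrafilter.eventually_imp]
  | all j φ ih =>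
    simp only [sat_all]
    rw [← not_iff_not, ← Ultrafilter.eventually_not]
    simp only [not_forall]
    refine Iff.trans ?_ (hex φ.not g j)
    constructor
    · rintro ⟨a, ha⟩
      induction a using Germ.inductionOn with
      | _ h =>
        simp only [update_germ, ih, ← Ultrafilter.eventually_not] at ha
        exact ⟨h, by simpa only [update_swap_apply, sat_not] using ha⟩
    · rintro ⟨h, hh⟩
      refine ⟨h, ?_⟩
      simp only [update_germ, ih, ← Ultrafilter.eventually_not]
      simpa only [update_swap_apply, sat_not] using hh
  | ex j φ ih =>
    simp only [sat_ex]
    refine Iff.trans ?_ (hex φ g j)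
    constructor
    · rintro ⟨a, ha⟩
      induction a using Germ.inductionOn with
      | _ h =>
        simp only [update_germ, ih] at ha
        exact ⟨h, by simpa only [update_swap_apply] using ha⟩
    · rintro ⟨h, hh⟩
      refine ⟨h, ?_⟩
      simp only [update_germ, ih]
      simpa only [update_swap_apply] using hh

/-- If the elements of `p` satisfying `χ` admit no bound for witnesses to `φ`, then some
elementary extension contains such an element with no witness in the hull. -/
theorem SatDB0.exists_elemEmb {M : Type} {EM : M → M → Prop} (hM : SatDB0 EM) (φ χ : Fml)
    (v : ℕ → M) (i j : ℕ) (p : M)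
    (H : ∀ q, ∃ x, EM x p ∧ Sat EM (update v i x) χ ∧
      ∀ y, EM y q → ¬ Sat EM (update (update v i x) j y) φ) :
    ∃ (N : Type) (EN : N → N → Prop) (f : M → N), ElemEmb EM EN f ∧
      ∃ x, EN x (f p) ∧ Sat EN (update (f ∘ v) i x) χ ∧
        ∀ y ∈ hull EN f, ¬ Sat EN (update (update (f ∘ v) i x) j y) φ := by
  have : Nonempty M := ⟨p⟩
  let A : M → Set M := fun q => {r | ∀ y, EM y q → EM y r}
  have : NeBot (⨅ q, 𝓟 (A q)) := by
    refine iInf_neBot_of_directed (fun q q' => ?_) fun q => ?_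
    · obtain ⟨s, hs⟩ := hM.2.2.1 q q'
      obtain ⟨r, hr⟩ := hM.2.2.2.1 s
      refine ⟨r, ?_, ?_⟩ <;> simp only [ge_iff_le, le_principal_iff, mem_principal] <;>
        intro t ht y hy
      · exact ht y ((hr y).2 ⟨q, (hs q).2 (.inl rfl), hy⟩)
      · exact ht y ((hr y).2 ⟨q', (hs q').2 (.inr rfl), hy⟩)
    · exact principal_neBot_iff.2 ⟨q, fun y hy => hy⟩
  let U : Ultrafilter M := Ultrafilter.of (⨅ q, 𝓟 (A q))
  have hU : ∀ q, ∀ᶠ r in U, ∀ y, EM y q → EM y r := fun q =>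
    Ultrafilter.of_le _ (mem_iInf_of_mem q (mem_principal_self _))
  choose x hxp hxχ hxφ using H
  let f : M → (U : Filter M).Germ M := fun m => ((fun _ => m : M → M) : (U : Filter M).Germ M)
  have hfv : f ∘ v = fun k => ((fun _ => v k : M → M) : (U : Filter M).Germ M) := rfl
  refine ⟨(U : Filter M).Germ M, Germ.LiftRel EM, f, fun ψ w => ?_, (x : (U : Filter M).Germ M),
    Germ.liftRel_coe.2 (.of_forall hxp), ?_, ?_⟩
  · have := sat_germ U EM ψ fun k _ => w k
    rw [eventually_const] at this
    exact this.symm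
  · rw [hfv, update_germ, sat_germ]
    exact .of_forall fun q => by simpa only [update_swap_apply] using hxχ q
  · rintro y ⟨q, hy⟩
    induction y using Germ.inductionOn with
    | _ y =>
      have hy : ∀ᶠ r in U, EM (y r) q := Germ.liftRel_coe.1 hy
      rw [hfv, update_germ, update_germ, sat_germ, ← Ultrafilter.eventually_not]
      filter_upwards [hy, hU q] with r hr hqr
      simpa only [update_swap_apply] using hxφ r (y r) (hqr _ hr)

/-- If the hull of `M` is `Σ_{n+1}`-elementary in every elementary extension, then `M` satisfies
strong `Σ_{n+1}`-collection. -/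
theorem HasEnd.collSScheme {n : ℕ} {M : Type} {EM : M → M → Prop} (hM : SatDB0 EM)
    (h : HasEnd (n + 1) EM) : CollSScheme EM (IsSigma (n + 1)) := by
  intro φ hφ hfv v p
  by_contra! hcon
  have hval : ∀ x y, Sat EM (val3 x y v) φ ↔ Sat EM (update (update (fun _ => v) 0 x) 1 y) φ := by
    intro x y
    refine sat_congr fun l hl => ?_
    rcases hfv hl with rfl | rfl | rfl <;> simp [val3]
  simp only [hval] at hcon
  obtain ⟨N, EN, f, hf, x, hx, hxχ, hxφ⟩ := hM.exists_elemEmb φ (.ex 1 φ) (fun _ => v) 0 1 p (by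
    intro q
    obtain ⟨x, hx, hxq⟩ := hcon q
    rcases hxq with ⟨h1, h2⟩ | ⟨h1, y, hy, hyφ⟩
    · exact ⟨x, hx, by simpa using h1, h2⟩
    · exact absurd hyφ (h1 y))
  have hf0 := (hf.sigmaElemEmb 0).delta0
  have hN := hf.satDB0 hM
  have htop := h N EN f hf
  have hu : ∀ k, update (f ∘ fun _ => v) 0 x k ∈ hull EN f := by
    intro k
    by_cases hk : k = 0
    · subst hk
      simpa using ⟨p, hx⟩
    · simpa [hk] using hf0.map_mem_hull hM v
  set u := update (f ∘ fun _ => v) 0 x with hudef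
  rw [isSigma_eq_lev] at hφ
  obtain ⟨j, ψ, hψ, rfl⟩ := hφ
  obtain ⟨c, ψ', hψ', hs⟩ := hψ.exists_fresh_pairing 1 j
  simp only [Fml.quant, sat_ex] at hxχ hxφ
  obtain ⟨y, z, hyz⟩ := hxχ
  obtain ⟨r, hr⟩ := hN.exists_oPair y z
  have hcψ' : Sat EN u (.ex c ψ') := sat_ex.2 ⟨r, ((hs N EN u r).1 y z hr).2 hyz⟩
  obtain ⟨r', hr', hrψ'⟩ := (htop (.ex c ψ') (by
    rw [isSigma_eq_lev]; exact ⟨c, ψ', hψ', rfl⟩) u hu).2 hcψ'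
  have hu' : ∀ k, update u c r' k ∈ hull EN f := by
    intro k
    by_cases hk : k = c
    · simpa [hk] using hr'
    · simpa [hk] using hu k
  have hd : ∀ a, ∀ k ∈ ψ'.fv, update (update u c r') (fresh ψ'.fv) a k = update u c r' k := by
    intro a k hk
    refine update_of_ne ?_ _ _
    rintro rfl
    exact fresh_notMem ψ'.fv_finite hk
  have hsat : Sat EN (update u c r') ψ' := by
    obtain ⟨a, ha⟩ := sat_ex.1 ((htop (.ex (fresh ψ'.fv) ψ') (by
      rw [isSigma_eq_lev]; exact ⟨_, ψ', hψ', rfl⟩) _ hu').1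
        ⟨r', hr', (satIn_congr (hd r')).2 hrψ'⟩)
    exact (sat_congr (hd a)).1 ha
  obtain ⟨y', z', hp⟩ := (hs N EN u r').2 hsat
  have hy' : y' ∈ hull EN f := by
    obtain ⟨s, t, hs, -, hst⟩ := hp
    exact hf0.mem_hull_trans hM (hf0.mem_hull_trans hM hr' ((hst s).2 (.inl rfl)))
      ((hs y').2 (.inl rfl))
  exact hxφ y' hy' ⟨z', ((hs N EN u r').1 y' z' hp).1 hsat⟩

theorem CollScheme.of_succ {n : ℕ} {M : Type} {E : M → M → Prop}
    (h : CollScheme E (IsSigma (n + 1))) : CollScheme E (IsSigma n) := by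
  intro φ hφ hfv
  rw [isSigma_eq_lev] at hφ
  obtain ⟨φ', h', hfv', hs⟩ := hφ.exists_succ
  have := h φ' (by rwa [isSigma_eq_lev]) (hfv'.trans hfv)
  simpa only [CollAx, hs] using this

theorem CollSScheme.collScheme {M : Type} {E : M → M → Prop} {Γ : Fml → Prop}
    (h : CollSScheme E Γ) : CollScheme E Γ := by
  intro φ hφ hfv v p hp
  obtain ⟨q, hq⟩ := h φ hφ hfv v p
  exact ⟨q, fun x hx => (hq x hx).1 (hp x hx)⟩

end FOSet

namespace FOSet

/-- For M ⊨ DB₀ and n ≥ 0, TFAE: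
(1) M ⊨ Coll_s(Σ_{n+1});
(2) if n = 0: every Σ₁-elementary extension N ⊨ DB₀ of M makes M* ≺_{Σ₁} N;
    if n ≥ 1: M ⊨ Coll(Σ_n), and every Σ_{n+1}-elementary extension
    N ⊨ DB₀ + Coll(Σ_{n-1}) of M makes M* ≺_{Σ_{n+1}} N;
(3) every Σ_{n+1}-elementary extension N ⊨ DB₀ of M makes M* ≺_{Σ_{n+1}} N. -/
theorem collS_tfae_refined (n : ℕ) (M : Type) (EM : M → M → Prop)
    (hM : SatDB0 EM) :
    [CollSScheme EM (IsSigma (n + 1)),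
     if n = 0 then
       ∀ (N : Type) (EN : N → N → Prop) (f : M → N), SatDB0 EN →
         SubStr EM EN f → SigmaElemEmb 1 EM EN f →
         SigmaElemInTop 1 EN (hull EN f)
     else
       CollScheme EM (IsSigma n) ∧
       ∀ (N : Type) (EN : N → N → Prop) (f : M → N),
         SatDB0 EN → CollScheme EN (IsSigma (n - 1)) →
         SubStr EM EN f → SigmaElemEmb (n + 1) EM EN f →
         SigmaElemInTop (n + 1) EN (hull EN f),
     ∀ (N : Type) (EN : N → N → Prop) (f : M → N), SatDB0 EN →
       SubStr EM EN f → SigmaElemEmb (n + 1) EM EN f →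
       SigmaElemInTop (n + 1) EN (hull EN f)].TFAE := by
  tfae_have 1 → 3 := fun h N EN f hN _ hf => h.sigmaElemInTop hM hN hf
  tfae_have 3 → 1 := fun h => HasEnd.collSScheme hM fun N EN f hf =>
    h N EN f (hf.satDB0 hM) hf.subStr (hf.sigmaElemEmb _)
  tfae_have 1 → 2 := fun h => by
    split_ifs with hn
    · subst hn
      exact fun N EN f hN _ hf => h.sigmaElemInTop hM hN hf
    · exact ⟨h.collScheme.of_succ, fun N EN f hN _ _ hf => h.sigmaElemInTop hM hN hf⟩
  tfae_have 2 → 1 := fun h => by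
    have : Nonempty M := hM.2.1.nonempty
    refine HasEnd.collSScheme hM fun N EN f hf => ?_
    split_ifs at h with hn
    · subst hn
      exact h N EN f (hf.satDB0 hM) hf.subStr (hf.sigmaElemEmb _)
    · obtain ⟨k, rfl⟩ := Nat.exists_eq_succ_of_ne_zero hn
      exact h.2 N EN f (hf.satDB0 hM) (hf.collScheme h.1.of_succ) hf.subStr (hf.sigmaElemEmb _)
  tfae_finish

end FOSet
end

section
/- Let M be a model of PA⁻ and let n ≥ 0. Then M satisfies the schema Coll_s(Σ_{n+1}) if and only if for every model N of PA⁻ with M ≺_{Σ_{n+1}} N, one has sup_N(M) ≺_{Σ_{n+1}} N. -/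
/- A deep embedding of the first-order language of arithmetic
   L_A = {0, 1, +, ·, <}, with named variables indexed by ℕ. -/

namespace FOArith

/-- Terms of L_A. -/
inductive Tm : Type
  | var : ℕ → Tm
  | zero : Tm
  | one : Tm
  | add : Tm → Tm → Tm
  | mul : Tm → Tm → Tm

namespace Tm

/-- Variables occurring in a term. -/
def fv : Tm → Set ℕ
  | var i => {i}
  | zero => ∅
  | one => ∅
  | add s t => s.fv ∪ t.fv
  | mul s t => s.fv ∪ t.fv

end Tm

/-- An L_A-structure on a type `M`. -/
structure ArithStr (M : Type) where
  zero : M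
  one : M
  add : M → M → M
  mul : M → M → M
  lt : M → M → Prop

/-- Value of a term under a valuation. -/
def Tm.val {M : Type} (A : ArithStr M) (v : ℕ → M) : Tm → M
  | .var i => v i
  | .zero => A.zero
  | .one => A.one
  | .add s t => A.add (s.val A v) (t.val A v)
  | .mul s t => A.mul (s.val A v) (t.val A v)

/-- Formulas of L_A. -/
inductive Fml : Type
  | lt : Tm → Tm → Fml
  | eq : Tm → Tm → Fml
  | not : Fml → Fml
  | and : Fml → Fml → Fml
  | or  : Fml → Fml → Fml
  | imp : Fml → Fml → Fml
  | all : ℕ → Fml → Fml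
  | ex  : ℕ → Fml → Fml

namespace Fml

/-- Free variables of a formula. -/
def fv : Fml → Set ℕ
  | lt s t => s.fv ∪ t.fv
  | eq s t => s.fv ∪ t.fv
  | not φ   => φ.fv
  | and φ ψ => φ.fv ∪ ψ.fv
  | or φ ψ  => φ.fv ∪ ψ.fv
  | imp φ ψ => φ.fv ∪ ψ.fv
  | all i φ => φ.fv \ {i}
  | ex i φ  => φ.fv \ {i}

end Fml

/-- Satisfaction, in the substructure of `(N, B)` with domain `S`, of a
formula under a valuation `v` : quantifiers range over `S`. -/
def SatIn {N : Type} (B : ArithStr N) (S : Set N) : (ℕ → N) → Fml → Prop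
  | v, .lt s t => B.lt (s.val B v) (t.val B v)
  | v, .eq s t => s.val B v = t.val B v
  | v, .not φ   => ¬ SatIn B S v φ
  | v, .and φ ψ => SatIn B S v φ ∧ SatIn B S v ψ
  | v, .or φ ψ  => SatIn B S v φ ∨ SatIn B S v ψ
  | v, .imp φ ψ => SatIn B S v φ → SatIn B S v ψ
  | v, .all i φ => ∀ a ∈ S, SatIn B S (Function.update v i a) φ
  | v, .ex i φ  => ∃ a ∈ S, SatIn B S (Function.update v i a) φ

/-- Satisfaction in the full structure. -/
def Sat {N : Type} (B : ArithStr N) (v : ℕ → N) (φ : Fml) : Prop :=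
  SatIn B Set.univ v φ

/-- Δ₀ (= Σ₀ = Π₀) formulas of L_A: every quantifier is bounded by a term,
i.e. of the form `∀ x < t` or `∃ x < t` with x not occurring in t. -/
inductive IsDelta0 : Fml → Prop
  | lt (s t : Tm) : IsDelta0 (Fml.lt s t)
  | eq (s t : Tm) : IsDelta0 (Fml.eq s t)
  | not {φ} : IsDelta0 φ → IsDelta0 φ.not
  | and {φ ψ} : IsDelta0 φ → IsDelta0 ψ → IsDelta0 (φ.and ψ)
  | or {φ ψ}  : IsDelta0 φ → IsDelta0 ψ → IsDelta0 (φ.or ψ)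
  | imp {φ ψ} : IsDelta0 φ → IsDelta0 ψ → IsDelta0 (φ.imp ψ)
  | ball {i : ℕ} {t : Tm} {φ} : i ∉ t.fv → IsDelta0 φ →
      IsDelta0 (Fml.all i ((Fml.lt (Tm.var i) t).imp φ))
  | bex {i : ℕ} {t : Tm} {φ} : i ∉ t.fv → IsDelta0 φ →
      IsDelta0 (Fml.ex i ((Fml.lt (Tm.var i) t).and φ))

/-- The arithmetical hierarchy: `(levels n).1` is the class of Σ_n formulas
and `(levels n).2` the class of Π_n formulas. -/
def levels : ℕ → (Fml → Prop) × (Fml → Prop)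
  | 0 => (IsDelta0, IsDelta0)
  | n + 1 =>
      (fun φ => ∃ i ψ, (levels n).2 ψ ∧ φ = Fml.ex i ψ,
       fun φ => ∃ i ψ, (levels n).1 ψ ∧ φ = Fml.all i ψ)

def IsSigma (n : ℕ) : Fml → Prop := (levels n).1

def IsPi (n : ℕ) : Fml → Prop := (levels n).2

variable {M N : Type}

/-- `(M, A) ⊨ PA⁻`: the (standard) finite axiomatization of the theory of the
nonnegative parts of discretely ordered commutative rings. -/
def SatPAminus (A : ArithStr M) : Prop :=
  (∀ x y z : M, A.add (A.add x y) z = A.add x (A.add y z)) ∧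
  (∀ x y : M, A.add x y = A.add y x) ∧
  (∀ x y z : M, A.mul (A.mul x y) z = A.mul x (A.mul y z)) ∧
  (∀ x y : M, A.mul x y = A.mul y x) ∧
  (∀ x y z : M, A.mul x (A.add y z) = A.add (A.mul x y) (A.mul x z)) ∧
  (∀ x : M, A.add x A.zero = x) ∧
  (∀ x : M, A.mul x A.zero = A.zero) ∧
  (∀ x : M, A.mul x A.one = x) ∧
  (∀ x y z : M, A.lt x y → A.lt y z → A.lt x z) ∧
  (∀ x : M, ¬ A.lt x x) ∧
  (∀ x y : M, A.lt x y ∨ x = y ∨ A.lt y x) ∧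
  (∀ x y z : M, A.lt x y → A.lt (A.add x z) (A.add y z)) ∧
  (∀ x y z : M, A.lt A.zero z → A.lt x y → A.lt (A.mul x z) (A.mul y z)) ∧
  (∀ x y : M, A.lt x y → ∃ z, A.add x z = y) ∧
  (A.lt A.zero A.one ∧ ∀ x : M, A.lt A.zero x → (A.one = x ∨ A.lt A.one x)) ∧
  (∀ x : M, A.zero = x ∨ A.lt A.zero x)

/-- Valuation sending 0 ↦ x, 1 ↦ y, everything else ↦ v; used for formulas
φ(x, y, v) with free variables among {0, 1, 2}. -/
def val3 (x y v : M) : ℕ → M := fun k => if k = 0 then x else if k = 1 then y else v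

/-- `M ⊨ Coll_s(φ)` for φ = φ(x, y, v) (x = var 0, y = var 1, v = var 2):
∀v∀p∃q∀x<p(∃y φ ↔ ∃y<q φ). -/
def CollSAx (A : ArithStr M) (φ : Fml) : Prop :=
  ∀ v p : M, ∃ q, ∀ x, A.lt x p →
    ((∃ y, Sat A (val3 x y v) φ) ↔ ∃ y, A.lt y q ∧ Sat A (val3 x y v) φ)

/-- The schema Coll_s(Γ) for a class Γ of formulas. -/
def CollSScheme (A : ArithStr M) (Γ : Fml → Prop) : Prop :=
  ∀ φ, Γ φ → φ.fv ⊆ {0, 1, 2} → CollSAx A φ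

/-- `f` embeds `(M, A)` as a substructure of `(N, B)`. -/
def ArithEmb (A : ArithStr M) (B : ArithStr N) (f : M → N) : Prop :=
  Function.Injective f ∧ f A.zero = B.zero ∧ f A.one = B.one ∧
  (∀ a b : M, f (A.add a b) = B.add (f a) (f b)) ∧
  (∀ a b : M, f (A.mul a b) = B.mul (f a) (f b)) ∧
  (∀ a b : M, A.lt a b ↔ B.lt (f a) (f b))

/-- `f : M → N` is a Σ_n-elementary embedding (M ≺_{Σ_n} N). -/
def SigmaElemEmb (n : ℕ) (A : ArithStr M) (B : ArithStr N) (f : M → N) : Prop :=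
  ∀ φ, IsSigma n φ → ∀ v : ℕ → M, Sat A v φ ↔ Sat B (f ∘ v) φ

/-- sup_N(M) = {a ∈ N : N ⊨ a < m for some m ∈ M}. -/
def supSet (B : ArithStr N) (f : M → N) : Set N := {a | ∃ m : M, B.lt a (f m)}

/-- The substructure of `N` with domain `S` is a Σ_n-elementary substructure
of `N` (S ≺_{Σ_n} N). -/
def SigmaElemInTop (n : ℕ) (B : ArithStr N) (S : Set N) : Prop :=
  ∀ φ, IsSigma n φ → ∀ v : ℕ → N, (∀ k, v k ∈ S) → (SatIn B S v φ ↔ Sat B v φ)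

/-! ### Variable bounds and renaming -/

/-- A strict upper bound for the variables of a term. -/
def Tm.bd : Tm → ℕ
  | var i => i + 1
  | zero => 0
  | one => 0
  | add s t => max s.bd t.bd
  | mul s t => max s.bd t.bd

/-- A strict upper bound for the free and bound variables of a formula. -/
def Fml.bd : Fml → ℕ
  | lt s t => max s.bd t.bd
  | eq s t => max s.bd t.bd
  | not φ => φ.bd
  | and φ ψ => max φ.bd ψ.bd
  | or φ ψ => max φ.bd ψ.bd
  | imp φ ψ => max φ.bd ψ.bd
  | all i φ => max (i + 1) φ.bd
  | ex i φ => max (i + 1) φ.bd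

theorem Tm.val_congr (B : ArithStr N) (t : Tm) {v w : ℕ → N}
    (h : ∀ k < t.bd, v k = w k) : t.val B v = t.val B w := by
  induction t with
  | var i => exact h i (Nat.lt_succ_self i)
  | zero => rfl
  | one => rfl
  | add s t ihs iht | mul s t ihs iht =>
    simp only [Tm.val]
    rw [ihs fun k hk => h k (lt_max_of_lt_left hk), iht fun k hk => h k (lt_max_of_lt_right hk)]

theorem satIn_congr (B : ArithStr N) (S : Set N) (φ : Fml) {v w : ℕ → N}
    (h : ∀ k < φ.bd, v k = w k) : SatIn B S v φ ↔ SatIn B S w φ := by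
  induction φ generalizing v w with
  | lt s t | eq s t =>
    simp only [SatIn]
    rw [s.val_congr B fun k hk => h k (lt_max_of_lt_left hk),
      t.val_congr B fun k hk => h k (lt_max_of_lt_right hk)]
  | not φ ih => simp only [SatIn]; rw [ih h]
  | and φ ψ ih₁ ih₂ | or φ ψ ih₁ ih₂ | imp φ ψ ih₁ ih₂ =>
    simp only [SatIn]
    rw [ih₁ fun k hk => h k (lt_max_of_lt_left hk), ih₂ fun k hk => h k (lt_max_of_lt_right hk)]
  | all i φ ih | ex i φ ih =>
    have key : ∀ a, SatIn B S (Function.update v i a) φ ↔ SatIn B S (Function.update w i a) φ := by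
      intro a
      refine ih fun k hk => ?_
      by_cases hki : k = i
      · subst hki; simp
      · simp only [Function.update_of_ne hki]; exact h k (lt_max_of_lt_right hk)
    simp only [SatIn, key]

theorem Tm.val_congr_fv (B : ArithStr N) (t : Tm) {v w : ℕ → N}
    (h : ∀ k ∈ t.fv, v k = w k) : t.val B v = t.val B w := by
  induction t with
  | var i => exact h i rfl
  | zero => rfl
  | one => rfl
  | add s t ihs iht | mul s t ihs iht =>
    simp only [Tm.val]
    rw [ihs fun k hk => h k (Or.inl hk), iht fun k hk => h k (Or.inr hk)]

/-- Renaming of the variables of a term. -/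
def Tm.rename (ρ : ℕ → ℕ) : Tm → Tm
  | var i => var (ρ i)
  | zero => zero
  | one => one
  | add s t => add (s.rename ρ) (t.rename ρ)
  | mul s t => mul (s.rename ρ) (t.rename ρ)

/-- A variable greater than `ρ k` for all `k < m`. -/
def freshVar (ρ : ℕ → ℕ) (m : ℕ) : ℕ := (Finset.range m).sup fun k => ρ k + 1

/-- Capture-avoiding renaming of the free variables of a formula. -/
def Fml.rename : (ℕ → ℕ) → Fml → Fml
  | ρ, lt s t => lt (s.rename ρ) (t.rename ρ)
  | ρ, eq s t => eq (s.rename ρ) (t.rename ρ)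
  | ρ, not φ => not (φ.rename ρ)
  | ρ, and φ ψ => and (φ.rename ρ) (ψ.rename ρ)
  | ρ, or φ ψ => or (φ.rename ρ) (ψ.rename ρ)
  | ρ, imp φ ψ => imp (φ.rename ρ) (ψ.rename ρ)
  | ρ, all i φ => all (freshVar ρ φ.bd) (φ.rename (Function.update ρ i (freshVar ρ φ.bd)))
  | ρ, ex i φ => ex (freshVar ρ φ.bd) (φ.rename (Function.update ρ i (freshVar ρ φ.bd)))

theorem lt_freshVar (ρ : ℕ → ℕ) {m k : ℕ} (hk : k < m) : ρ k < freshVar ρ m :=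
  Finset.le_sup (f := fun k => ρ k + 1) (Finset.mem_range.2 hk)

theorem Tm.val_rename (B : ArithStr N) (ρ : ℕ → ℕ) (t : Tm) (v : ℕ → N) :
    (t.rename ρ).val B v = t.val B (v ∘ ρ) := by
  induction t with
  | var i => rfl
  | zero => rfl
  | one => rfl
  | add s t ihs iht | mul s t ihs iht => simp only [Tm.rename, Tm.val, ihs, iht]

theorem satIn_rename (B : ArithStr N) (S : Set N) (φ : Fml) (ρ : ℕ → ℕ) (v : ℕ → N) :
    SatIn B S v (φ.rename ρ) ↔ SatIn B S (v ∘ ρ) φ := by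
  induction φ generalizing v ρ with
  | lt s t | eq s t => simp only [Fml.rename, SatIn, Tm.val_rename]
  | not φ ih => simp only [Fml.rename, SatIn, ih]
  | and φ ψ ih₁ ih₂ | or φ ψ ih₁ ih₂ | imp φ ψ ih₁ ih₂ => simp only [Fml.rename, SatIn, ih₁, ih₂]
  | all i φ ih | ex i φ ih =>
    have key : ∀ a, SatIn B S (Function.update v (freshVar ρ φ.bd) a ∘
        Function.update ρ i (freshVar ρ φ.bd)) φ ↔ SatIn B S (Function.update (v ∘ ρ) i a) φ := by
      intro a
      refine satIn_congr B S φ fun k hk => ?_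
      by_cases hki : k = i
      · subst hki; simp
      · simp [Function.update_of_ne hki, Function.update_of_ne (lt_freshVar ρ hk).ne]
    simp only [Fml.rename, SatIn, ih, key]

theorem Tm.lt_bd_of_mem_fv {t : Tm} {k : ℕ} (h : k ∈ t.fv) : k < t.bd := by
  induction t with
  | var i => simp only [Tm.fv, Set.mem_singleton_iff] at h; simp [Tm.bd, h]
  | zero => exact h.elim
  | one => exact h.elim
  | add s t ihs iht | mul s t ihs iht =>
    exact h.elim (fun h => lt_max_of_lt_left (ihs h)) fun h => lt_max_of_lt_right (iht h)

theorem Tm.mem_fv_rename {ρ : ℕ → ℕ} {t : Tm} {m : ℕ} (h : m ∈ (t.rename ρ).fv) :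
    ∃ k ∈ t.fv, ρ k = m := by
  induction t with
  | var i => exact ⟨i, rfl, h.symm⟩
  | zero => exact h.elim
  | one => exact h.elim
  | add s t ihs iht | mul s t ihs iht =>
    rcases h with h | h
    · obtain ⟨k, hk, e⟩ := ihs h
      exact ⟨k, Or.inl hk, e⟩
    · obtain ⟨k, hk, e⟩ := iht h
      exact ⟨k, Or.inr hk, e⟩

theorem Fml.fv_rename_subset {ρ : ℕ → ℕ} {φ : Fml} {T : Set ℕ} (h : ∀ k, ρ k ∈ T) :
    (φ.rename ρ).fv ⊆ T := by
  have tm : ∀ t : Tm, (t.rename ρ).fv ⊆ T := fun t m hm => by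
    obtain ⟨k, -, rfl⟩ := Tm.mem_fv_rename hm
    exact h k
  induction φ generalizing ρ T with
  | lt s t | eq s t => exact Set.union_subset (tm s) (tm t)
  | not φ ih => exact ih h tm
  | and φ ψ ih₁ ih₂ | or φ ψ ih₁ ih₂ | imp φ ψ ih₁ ih₂ =>
    exact Set.union_subset (ih₁ h tm) (ih₂ h tm)
  | all i φ ih | ex i φ ih =>
    simp only [Fml.rename, Fml.fv]
    rw [Set.sdiff_subset_iff]
    have h' : ∀ k, Function.update ρ i (freshVar ρ φ.bd) k ∈ {freshVar ρ φ.bd} ∪ T := by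
      intro k
      by_cases hki : k = i
      · subst hki; simp
      · rw [Function.update_of_ne hki]; exact Or.inr (h k)
    refine ih h' fun t m hm => ?_
    obtain ⟨k, -, rfl⟩ := Tm.mem_fv_rename hm
    exact h' k

theorem freshVar_notMem_fv {ρ : ℕ → ℕ} {t : Tm} {i m : ℕ} (hi : i ∉ t.fv) (hm : t.bd ≤ m) :
    freshVar ρ m ∉ (t.rename (Function.update ρ i (freshVar ρ m))).fv := by
  intro h
  obtain ⟨k, hk, e⟩ := Tm.mem_fv_rename h
  have hki : k ≠ i := fun e => hi (e ▸ hk)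
  rw [Function.update_of_ne hki] at e
  exact (lt_freshVar ρ ((Tm.lt_bd_of_mem_fv hk).trans_le hm)).ne e

theorem IsDelta0.rename {φ : Fml} (h : IsDelta0 φ) (ρ : ℕ → ℕ) : IsDelta0 (φ.rename ρ) := by
  induction h generalizing ρ with
  | lt s t => exact .lt _ _
  | eq s t => exact .eq _ _
  | not _ ih => exact .not (ih ρ)
  | and _ _ ih₁ ih₂ => exact .and (ih₁ ρ) (ih₂ ρ)
  | or _ _ ih₁ ih₂ => exact .or (ih₁ ρ) (ih₂ ρ)
  | imp _ _ ih₁ ih₂ => exact .imp (ih₁ ρ) (ih₂ ρ)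
  | ball hi _ ih =>
    simp only [Fml.rename, Tm.rename, Function.update_self]
    exact .ball (freshVar_notMem_fv hi (by simp [Fml.bd])) (ih _)
  | bex hi _ ih =>
    simp only [Fml.rename, Tm.rename, Function.update_self]
    exact .bex (freshVar_notMem_fv hi (by simp [Fml.bd])) (ih _)

theorem IsPi.ex {k : ℕ} {φ : Fml} (h : IsPi k φ) (i : ℕ) : IsSigma (k + 1) (Fml.ex i φ) :=
  ⟨i, φ, h, rfl⟩

theorem IsSigma.all {k : ℕ} {φ : Fml} (h : IsSigma k φ) (i : ℕ) : IsPi (k + 1) (Fml.all i φ) :=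
  ⟨i, φ, h, rfl⟩

theorem rename_levels (k : ℕ) :
    (∀ φ ρ, IsSigma k φ → IsSigma k (φ.rename ρ)) ∧ ∀ φ ρ, IsPi k φ → IsPi k (φ.rename ρ) := by
  induction k with
  | zero => exact ⟨fun _ ρ h => IsDelta0.rename h ρ, fun _ ρ h => IsDelta0.rename h ρ⟩
  | succ k ih =>
    constructor
    · rintro _ ρ ⟨i, ψ, hψ, rfl⟩
      exact IsPi.ex (ih.2 ψ _ hψ) _
    · rintro _ ρ ⟨i, ψ, hψ, rfl⟩
      exact IsSigma.all (ih.1 ψ _ hψ) _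

theorem IsSigma.rename {k : ℕ} {φ : Fml} (h : IsSigma k φ) (ρ : ℕ → ℕ) :
    IsSigma k (φ.rename ρ) := (rename_levels k).1 φ ρ h

theorem IsPi.rename {k : ℕ} {φ : Fml} (h : IsPi k φ) (ρ : ℕ → ℕ) :
    IsPi k (φ.rename ρ) := (rename_levels k).2 φ ρ h

theorem exists_negation (k : ℕ) :
    (∀ φ, IsSigma k φ → ∃ φ', IsPi k φ' ∧ φ'.bd = φ.bd ∧
      ∀ (N : Type) (B : ArithStr N) S v, SatIn B S v φ' ↔ ¬ SatIn B S v φ) ∧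
    (∀ φ, IsPi k φ → ∃ φ', IsSigma k φ' ∧ φ'.bd = φ.bd ∧
      ∀ (N : Type) (B : ArithStr N) S v, SatIn B S v φ' ↔ ¬ SatIn B S v φ) := by
  induction k with
  | zero =>
    exact ⟨fun φ h => ⟨φ.not, IsDelta0.not h, rfl, fun _ _ _ _ => Iff.rfl⟩,
      fun φ h => ⟨φ.not, IsDelta0.not h, rfl, fun _ _ _ _ => Iff.rfl⟩⟩
  | succ k ih =>
    constructor
    · rintro _ ⟨i, ψ, hψ, rfl⟩
      obtain ⟨ψ', h₁, h₂, h₃⟩ := ih.2 ψ hψ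
      exact ⟨_, h₁.all i, by simp [Fml.bd, h₂], fun N B S v => by simp [SatIn, h₃]⟩
    · rintro _ ⟨i, ψ, hψ, rfl⟩
      obtain ⟨ψ', h₁, h₂, h₃⟩ := ih.1 ψ hψ
      exact ⟨_, h₁.ex i, by simp [Fml.bd, h₂], fun N B S v => by simp [SatIn, h₃]⟩

theorem satIn_ex_bd (B : ArithStr N) {S : Set N} (hS : S.Nonempty) (φ : Fml) (v : ℕ → N) :
    SatIn B S v (Fml.ex φ.bd φ) ↔ SatIn B S v φ := by
  have key : ∀ a, SatIn B S (Function.update v φ.bd a) φ ↔ SatIn B S v φ := fun a =>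
    satIn_congr B S φ fun k hk => Function.update_of_ne hk.ne _ _
  obtain ⟨a, ha⟩ := hS
  simp only [SatIn, key]
  exact ⟨fun ⟨_, _, h⟩ => h, fun h => ⟨a, ha, h⟩⟩

theorem satIn_all_bd (B : ArithStr N) {S : Set N} (hS : S.Nonempty) (φ : Fml) (v : ℕ → N) :
    SatIn B S v (Fml.all φ.bd φ) ↔ SatIn B S v φ := by
  have key : ∀ a, SatIn B S (Function.update v φ.bd a) φ ↔ SatIn B S v φ := fun a =>
    satIn_congr B S φ fun k hk => Function.update_of_ne hk.ne _ _
  obtain ⟨a, ha⟩ := hS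
  simp only [SatIn, key]
  exact ⟨fun h => h a ha, fun h _ _ => h⟩

theorem exists_raise_succ (k : ℕ) :
    (∀ φ, IsSigma k φ → ∃ φ', IsSigma (k + 1) φ' ∧
      ∀ (N : Type) (B : ArithStr N) S, S.Nonempty → ∀ v, SatIn B S v φ' ↔ SatIn B S v φ) ∧
    (∀ φ, IsPi k φ → ∃ φ', IsPi (k + 1) φ' ∧
      ∀ (N : Type) (B : ArithStr N) S, S.Nonempty → ∀ v, SatIn B S v φ' ↔ SatIn B S v φ) := by
  induction k with
  | zero =>
    exact ⟨fun φ h => ⟨_, IsPi.ex (k := 0) h φ.bd, fun _ B _ hS v => satIn_ex_bd B hS φ v⟩,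
      fun φ h => ⟨_, IsSigma.all (k := 0) h φ.bd, fun _ B _ hS v => satIn_all_bd B hS φ v⟩⟩
  | succ k ih =>
    constructor
    · rintro _ ⟨i, ψ, hψ, rfl⟩
      obtain ⟨ψ', h₁, h₂⟩ := ih.2 ψ hψ
      exact ⟨_, h₁.ex i, fun N B S hS v => by simp [SatIn, h₂ N B S hS]⟩
    · rintro _ ⟨i, ψ, hψ, rfl⟩
      obtain ⟨ψ', h₁, h₂⟩ := ih.1 ψ hψ
      exact ⟨_, h₁.all i, fun N B S hS v => by simp [SatIn, h₂ N B S hS]⟩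

theorem IsPi.exists_raise {k n : ℕ} (hkn : k ≤ n) {φ : Fml} (h : IsPi k φ) :
    ∃ φ', IsPi n φ' ∧
      ∀ (N : Type) (B : ArithStr N) S, S.Nonempty → ∀ v, SatIn B S v φ' ↔ SatIn B S v φ := by
  induction n, hkn using Nat.le_induction with
  | base => exact ⟨φ, h, fun _ _ _ _ _ => Iff.rfl⟩
  | succ n _ ih =>
    obtain ⟨φ₁, h₁, e₁⟩ := ih
    obtain ⟨φ₂, h₂, e₂⟩ := (exists_raise_succ n).2 φ₁ h₁
    exact ⟨φ₂, h₂, fun N B S hS v => (e₂ N B S hS v).trans (e₁ N B S hS v)⟩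

/-! ### Ordered algebra in models of PA⁻ -/

/-- The semiring structure of a model of PA⁻. -/
abbrev SatPAminus.commSemiring {B : ArithStr N} (h : SatPAminus B) : CommSemiring N :=
  letI : Zero N := ⟨B.zero⟩
  letI : One N := ⟨B.one⟩
  letI : Add N := ⟨B.add⟩
  letI : Mul N := ⟨B.mul⟩
  have ha : ∀ x y : N, x + y = y + x := h.2.1
  have hm : ∀ x y : N, x * y = y * x := h.2.2.2.1
  have hd : ∀ x y z : N, x * (y + z) = x * y + x * z := h.2.2.2.2.1
  have h0 : ∀ x : N, x + 0 = x := h.2.2.2.2.2.1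
  have hm0 : ∀ x : N, x * 0 = 0 := h.2.2.2.2.2.2.1
  have hm1 : ∀ x : N, x * 1 = x := h.2.2.2.2.2.2.2.1
  { add_assoc := h.1
    add_comm := ha
    mul_assoc := h.2.2.1
    mul_comm := hm
    left_distrib := hd
    right_distrib := fun x y z => by rw [hm, hd, hm z x, hm z y]
    add_zero := h0
    zero_add := fun x => by rw [ha, h0]
    mul_zero := hm0
    zero_mul := fun x => by rw [hm, hm0]
    mul_one := hm1
    one_mul := fun x => by rw [hm, hm1]
    nsmul := nsmulRec
    npow := npowRec }

open Classical in
/-- The linear order of a model of PA⁻. -/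
noncomputable abbrev SatPAminus.linearOrder {B : ArithStr N} (h : SatPAminus B) :
    LinearOrder N :=
  have tr : ∀ x y z : N, B.lt x y → B.lt y z → B.lt x z := h.2.2.2.2.2.2.2.2.1
  have irr : ∀ x : N, ¬ B.lt x x := h.2.2.2.2.2.2.2.2.2.1
  have tri : ∀ x y : N, B.lt x y ∨ x = y ∨ B.lt y x := h.2.2.2.2.2.2.2.2.2.2.1
  { le := fun x y => x = y ∨ B.lt x y
    lt := B.lt
    le_refl := fun _ => Or.inl rfl
    le_trans := by
      rintro x y z (rfl | hxy) (rfl | hyz)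
      · exact Or.inl rfl
      · exact Or.inr hyz
      · exact Or.inr hxy
      · exact Or.inr (tr _ _ _ hxy hyz)
    lt_iff_le_not_ge := fun x y => by
      constructor
      · refine fun hxy => ⟨Or.inr hxy, ?_⟩
        rintro (rfl | hyx)
        · exact irr _ hxy
        · exact irr _ (tr _ _ _ hxy hyx)
      · rintro ⟨rfl | hxy, hyx⟩
        · exact (hyx (Or.inl rfl)).elim
        · exact hxy
    le_antisymm := by
      rintro x y (rfl | hxy) (e | hyx)
      · rfl
      · rfl
      · exact e.symm
      · exact (irr _ (tr _ _ _ hxy hyx)).elim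
    le_total := fun x y => by
      rcases tri x y with hxy | rfl | hyx
      · exact Or.inl (Or.inr hxy)
      · exact Or.inl (Or.inl rfl)
      · exact Or.inr (Or.inr hyx)
    toDecidableLE := fun _ _ => Classical.propDecidable _ }

theorem SatPAminus.isStrictOrderedRing {B : ArithStr N} (h : SatPAminus B) :
    letI := h.commSemiring
    letI := h.linearOrder
    IsStrictOrderedRing N := by
  let := h.commSemiring
  let := h.linearOrder
  have hadd : ∀ x y z : N, x < y → x + z < y + z := h.2.2.2.2.2.2.2.2.2.2.2.1
  have hmul : ∀ x y z : N, 0 < z → x < y → x * z < y * z := h.2.2.2.2.2.2.2.2.2.2.2.2.1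
  have h01 : (0 : N) < 1 := h.2.2.2.2.2.2.2.2.2.2.2.2.2.2.1.1
  have hle : ∀ x y : N, x ≤ y → ∀ z, z + x ≤ z + y := fun x y hxy z => by
    rcases hxy.eq_or_lt with rfl | hxy
    · exact le_rfl
    · rw [add_comm z, add_comm z]; exact (hadd x y z hxy).le
  exact
    { add_le_add_left := fun x y hxy z => by
        simpa [add_comm] using hle x y hxy z
      le_of_add_le_add_left := fun z x y hxy => by
        by_contra hlt
        have := hadd y x z (not_le.1 hlt)
        rw [add_comm y, add_comm x] at this
        exact absurd hxy (not_le.2 this)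
      zero_le_one := h01.le
      exists_pair_ne := ⟨0, 1, h01.ne⟩
      mul_lt_mul_of_pos_left := fun z hz x y hxy => by
        change z * x < z * y
        rw [mul_comm z, mul_comm z]; exact hmul _ _ _ hz hxy
      mul_lt_mul_of_pos_right := fun z hz x y hxy => hmul _ _ _ hz hxy }

/-- The pairing polynomial `(x + y)² + x`. -/
def pairing (B : ArithStr N) (x y : N) : N :=
  B.add (B.mul (B.add x y) (B.add x y)) x

theorem SatPAminus.zero_le {B : ArithStr N} (h : SatPAminus B) :
    letI := h.commSemiring
    letI := h.linearOrder
    ∀ x : N, 0 ≤ x := h.2.2.2.2.2.2.2.2.2.2.2.2.2.2.2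

theorem SatPAminus.add_one_le {B : ArithStr N} (h : SatPAminus B) :
    letI := h.commSemiring
    letI := h.linearOrder
    ∀ x y : N, x < y → x + 1 ≤ y := by
  let := h.commSemiring
  let := h.linearOrder
  have := h.isStrictOrderedRing
  have hsub : ∀ x y : N, x < y → ∃ z, x + z = y := h.2.2.2.2.2.2.2.2.2.2.2.2.2.1
  have h1 : ∀ x : N, 0 < x → 1 ≤ x := h.2.2.2.2.2.2.2.2.2.2.2.2.2.2.1.2
  intro x y hxy
  obtain ⟨z, rfl⟩ := hsub x y hxy
  have hz : 0 < z := by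
    rcases (h.zero_le z).eq_or_lt with e | hz
    · rw [← e, add_zero] at hxy; exact absurd hxy (lt_irrefl _)
    · exact hz
  gcongr
  exact h1 z hz

theorem SatPAminus.le_pairing {B : ArithStr N} (h : SatPAminus B) (x y : N) :
    letI := h.linearOrder
    x ≤ pairing B x y ∧ y ≤ pairing B x y := by
  let := h.commSemiring
  let := h.linearOrder
  have := h.isStrictOrderedRing
  have hx := h.zero_le x
  have hy := h.zero_le y
  change x ≤ (x + y) * (x + y) + x ∧ y ≤ (x + y) * (x + y) + x
  have hs : x + y ≤ (x + y) * (x + y) := by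
    rcases (h.zero_le (x + y)).eq_or_lt with e | hs
    · rw [← e]; simp
    · have h1 := h.add_one_le 0 (x + y) hs
      rw [zero_add] at h1
      exact le_mul_of_one_le_right hs.le h1
  exact ⟨le_add_of_nonneg_left (add_nonneg hx hy |>.trans hs),
    (le_add_of_nonneg_left hx).trans (hs.trans (le_add_of_nonneg_right hx))⟩

theorem SatPAminus.pairing_inj {B : ArithStr N} (h : SatPAminus B)
    {x y x' y' : N} (e : pairing B x y = pairing B x' y') :
    x = x' ∧ y = y' := by
  let := h.commSemiring
  let := h.linearOrder
  have := h.isStrictOrderedRing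
  have key : ∀ x y x' y' : N, x + y < x' + y' →
      (x + y) * (x + y) + x < (x' + y') * (x' + y') + x' := by
    intro x y x' y' hlt
    have hs := h.zero_le (x + y)
    calc (x + y) * (x + y) + x
        ≤ (x + y) * (x + y) + (x + y) := by gcongr; exact le_add_of_nonneg_right (h.zero_le y)
      _ < (x + y) * (x + y) + (x + y) + ((x + y) + 1) :=
          lt_add_of_pos_right _ (add_pos_of_nonneg_of_pos hs zero_lt_one)
      _ = (x + y + 1) * (x + y + 1) := by ring
      _ ≤ (x' + y') * (x' + y') :=
          mul_le_mul (h.add_one_le _ _ hlt) (h.add_one_le _ _ hlt)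
            (add_nonneg hs zero_le_one) (h.zero_le _)
      _ ≤ (x' + y') * (x' + y') + x' := le_add_of_nonneg_right (h.zero_le x')
  change (x + y) * (x + y) + x = (x' + y') * (x' + y') + x' at e
  have hsum : x + y = x' + y' := by
    rcases lt_trichotomy (x + y) (x' + y') with hlt | heq | hlt
    · exact absurd e (key _ _ _ _ hlt).ne
    · exact heq
    · exact absurd e.symm (key _ _ _ _ hlt).ne
  rw [hsum] at e
  have hx : x = x' := add_left_cancel e
  subst hx
  exact ⟨rfl, add_left_cancel hsum⟩

theorem SatPAminus.pairing_lt {B : ArithStr N} (h : SatPAminus B)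
    {x y x' y' : N} (hx : B.lt x x') (hy : B.lt y y') :
    B.lt (pairing B x y) (pairing B x' y') := by
  let := h.commSemiring
  let := h.linearOrder
  have := h.isStrictOrderedRing
  change x < x' at hx
  change y < y' at hy
  change (x + y) * (x + y) + x < (x' + y') * (x' + y') + x'
  have := h.zero_le x
  have := h.zero_le y
  gcongr

theorem SatPAminus.lt_add_one {B : ArithStr N} (h : SatPAminus B)
    (x : N) : B.lt x (B.add x B.one) := by
  let := h.commSemiring
  let := h.linearOrder
  have := h.isStrictOrderedRing
  exact _root_.lt_add_one x

theorem SatPAminus.lt_add_one_of_le {B : ArithStr N} (h : SatPAminus B)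
    {x y : N} (hxy : letI := h.linearOrder; x ≤ y) :
    B.lt x (B.add y B.one) := by
  let := h.linearOrder
  exact lt_of_le_of_lt hxy (h.lt_add_one y)

theorem SatPAminus.lt_trans {B : ArithStr N} (h : SatPAminus B)
    {x y z : N} (hxy : B.lt x y) (hyz : B.lt y z) : B.lt x z :=
  h.2.2.2.2.2.2.2.2.1 _ _ _ hxy hyz

theorem SatPAminus.exists_gt₂ {B : ArithStr N} (h : SatPAminus B)
    (x y : N) : ∃ z, B.lt x z ∧ B.lt y z := by
  let := h.linearOrder
  exact ⟨B.add (max x y) B.one, h.lt_add_one_of_le (le_max_left x y),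
    h.lt_add_one_of_le (le_max_right x y)⟩

theorem SatPAminus.exists_bound {B : ArithStr N} (h : SatPAminus B)
    (b : ℕ) (u : ℕ → N) : ∃ p, ∀ j < b, B.lt (u j) p := by
  induction b with
  | zero => exact ⟨B.zero, fun _ hj => absurd hj (Nat.not_lt_zero _)⟩
  | succ b ih =>
    obtain ⟨p, hp⟩ := ih
    obtain ⟨q, hpq, hq⟩ := h.exists_gt₂ p (u b)
    refine ⟨q, fun j hj => ?_⟩
    rcases Nat.lt_succ_iff_lt_or_eq.1 hj with hj | rfl
    · exact h.lt_trans (hp j hj) hpq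
    · exact hq

/-- `S` is a nonempty initial segment of a model of PA⁻ closed under the operations. -/
structure IsCut (B : ArithStr N) (S : Set N) : Prop where
  sat : SatPAminus B
  zero_mem : B.zero ∈ S
  one_mem : B.one ∈ S
  add_mem : ∀ x ∈ S, ∀ y ∈ S, B.add x y ∈ S
  mul_mem : ∀ x ∈ S, ∀ y ∈ S, B.mul x y ∈ S
  mem_of_lt : ∀ x, ∀ y ∈ S, B.lt x y → x ∈ S

theorem isCut_univ {B : ArithStr N} (h : SatPAminus B) : IsCut B Set.univ :=
  ⟨h, trivial, trivial, fun _ _ _ _ => trivial, fun _ _ _ _ => trivial, fun _ _ _ _ => trivial⟩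

theorem IsCut.nonempty {B : ArithStr N} {S : Set N} (h : IsCut B S) : S.Nonempty :=
  ⟨_, h.zero_mem⟩

theorem IsCut.pairing_mem {B : ArithStr N} {S : Set N} (h : IsCut B S) {x y : N}
    (hx : x ∈ S) (hy : y ∈ S) : pairing B x y ∈ S :=
  h.add_mem _ (h.mul_mem _ (h.add_mem _ hx _ hy) _ (h.add_mem _ hx _ hy)) _ hx

theorem mem_supSet {A : ArithStr M} {B : ArithStr N} {f : M → N} (hB : SatPAminus B)
    (hf : ArithEmb A B f) (m : M) : f m ∈ supSet B f := by
  refine ⟨A.add m A.one, ?_⟩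
  rw [hf.2.2.2.1, hf.2.2.1]
  exact hB.lt_add_one _

theorem isCut_supSet {A : ArithStr M} {B : ArithStr N} {f : M → N} (hB : SatPAminus B)
    (hf : ArithEmb A B f) : IsCut B (supSet B f) where
  sat := hB
  zero_mem := hf.2.1 ▸ mem_supSet hB hf A.zero
  one_mem := hf.2.2.1 ▸ mem_supSet hB hf A.one
  add_mem := by
    let := hB.commSemiring
    let := hB.linearOrder
    have := hB.isStrictOrderedRing
    rintro x ⟨m, hm⟩ y ⟨m', hm'⟩
    refine ⟨A.add m m', ?_⟩
    rw [hf.2.2.2.1]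
    exact add_lt_add (show x < f m from hm) (show y < f m' from hm')
  mul_mem := by
    let := hB.commSemiring
    let := hB.linearOrder
    have := hB.isStrictOrderedRing
    rintro x ⟨m, hm⟩ y ⟨m', hm'⟩
    refine ⟨A.mul m m', ?_⟩
    rw [hf.2.2.2.2.1]
    exact mul_lt_mul'' (show x < f m from hm) (show y < f m' from hm') (hB.zero_le x) (hB.zero_le y)
  mem_of_lt := fun x y ⟨m, hm⟩ hxy => ⟨m, hB.lt_trans hxy hm⟩

theorem IsCut.val_mem {B : ArithStr N} {S : Set N} (h : IsCut B S) {v : ℕ → N}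
    (hv : ∀ k, v k ∈ S) (t : Tm) : t.val B v ∈ S := by
  induction t with
  | var i => exact hv i
  | zero => exact h.zero_mem
  | one => exact h.one_mem
  | add s t ihs iht => exact h.add_mem _ ihs _ iht
  | mul s t ihs iht => exact h.mul_mem _ ihs _ iht

theorem update_mem {S : Set N} {v : ℕ → N} (hv : ∀ k, v k ∈ S) (i : ℕ) {a : N} (ha : a ∈ S)
    (k : ℕ) : Function.update v i a k ∈ S := by
  by_cases hk : k = i
  · subst hk; simpa using ha
  · rw [Function.update_of_ne hk]; exact hv k

theorem IsDelta0.satIn_iff {B : ArithStr N} {S : Set N} (h : IsCut B S) {φ : Fml}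
    (hφ : IsDelta0 φ) {v : ℕ → N} (hv : ∀ k, v k ∈ S) : SatIn B S v φ ↔ Sat B v φ := by
  unfold Sat
  induction hφ generalizing v with
  | lt s t => exact Iff.rfl
  | eq s t => exact Iff.rfl
  | not _ ih => exact not_congr (ih hv)
  | and _ _ ih₁ ih₂ => exact and_congr (ih₁ hv) (ih₂ hv)
  | or _ _ ih₁ ih₂ => exact or_congr (ih₁ hv) (ih₂ hv)
  | imp _ _ ih₁ ih₂ => exact imp_congr (ih₁ hv) (ih₂ hv)
  | @ball i t φ hi _ ih =>
    have ht : ∀ a, t.val B (Function.update v i a) = t.val B v := fun a =>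
      t.val_congr_fv B fun k hk =>
        Function.update_of_ne (ne_of_mem_of_not_mem hk hi) _ _
    simp only [SatIn, Tm.val, Function.update_self, ht]
    exact ⟨fun H a _ hlt => (ih (update_mem hv i (h.mem_of_lt _ _ (h.val_mem hv t) hlt))).1
      (H a (h.mem_of_lt _ _ (h.val_mem hv t) hlt) hlt),
      fun H a ha hlt => (ih (update_mem hv i ha)).2 (H a trivial hlt)⟩
  | @bex i t φ hi _ ih =>
    have ht : ∀ a, t.val B (Function.update v i a) = t.val B v := fun a =>
      t.val_congr_fv B fun k hk =>
        Function.update_of_ne (ne_of_mem_of_not_mem hk hi) _ _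
    simp only [SatIn, Tm.val, Function.update_self, ht]
    exact ⟨fun ⟨a, ha, hlt, H⟩ => ⟨a, trivial, hlt, (ih (update_mem hv i ha)).1 H⟩,
      fun ⟨a, _, hlt, H⟩ => ⟨a, h.mem_of_lt _ _ (h.val_mem hv t) hlt, hlt,
        (ih (update_mem hv i (h.mem_of_lt _ _ (h.val_mem hv t) hlt))).2 H⟩⟩

/-! ### Closure properties of the arithmetical hierarchy -/

/-- Prepend an element to a valuation. -/
def vcons (a : N) (v : ℕ → N) : ℕ → N
  | 0 => a
  | k + 1 => v k

@[simp] theorem vcons_zero (a : N) (v : ℕ → N) : vcons a v 0 = a := rfl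

@[simp] theorem vcons_succ (a : N) (v : ℕ → N) (k : ℕ) : vcons a v (k + 1) = v k := rfl

theorem vcons_mem {S : Set N} {a : N} {v : ℕ → N} (ha : a ∈ S) (hv : ∀ k, v k ∈ S) (k : ℕ) :
    vcons a v k ∈ S := by
  cases k with
  | zero => exact ha
  | succ k => exact hv k

theorem comp_vcons (f : M → N) (a : M) (v : ℕ → M) : f ∘ vcons a v = vcons (f a) (f ∘ v) := by
  funext k
  cases k <;> rfl

theorem vcons_comp_eq_update (a : N) (v : ℕ → N) (i : ℕ) :
    vcons a v ∘ (fun j => if j = i then 0 else j + 1) = Function.update v i a := by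
  funext j
  by_cases hj : j = i
  · subst hj; simp
  · simp [hj]

theorem satIn_update_bd (B : ArithStr N) (S : Set N) (ψ : Fml) (a : N) (v : ℕ → N) :
    SatIn B S (Function.update v ψ.bd a ∘ vcons ψ.bd id) ψ ↔
      SatIn B S (vcons a v) ψ := by
  refine satIn_congr B S ψ fun k hk => ?_
  cases k with
  | zero => simp
  | succ k => simp [Function.update_of_ne (show k ≠ ψ.bd by omega)]

theorem IsPi.exists_ex {k : ℕ} {ψ : Fml} (h : IsPi k ψ) :
    ∃ φ, IsSigma (k + 1) φ ∧ ∀ (N : Type) (B : ArithStr N) S v,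
      SatIn B S v φ ↔ ∃ a ∈ S, SatIn B S (vcons a v) ψ :=
  ⟨_, (h.rename (vcons ψ.bd id)).ex ψ.bd, fun N B S v => by
    simp only [SatIn, satIn_rename, satIn_update_bd]⟩

theorem IsSigma.exists_all {k : ℕ} {ψ : Fml} (h : IsSigma k ψ) :
    ∃ φ, IsPi (k + 1) φ ∧ ∀ (N : Type) (B : ArithStr N) S v,
      SatIn B S v φ ↔ ∀ a ∈ S, SatIn B S (vcons a v) ψ :=
  ⟨_, (h.rename (vcons ψ.bd id)).all ψ.bd, fun N B S v => by
    simp only [SatIn, satIn_rename, satIn_update_bd]⟩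

theorem exists_and_delta0 (k : ℕ) :
    (∀ φ δ, IsSigma k φ → IsDelta0 δ → ∃ φ', IsSigma k φ' ∧
      ∀ (N : Type) (B : ArithStr N) S, S.Nonempty → ∀ v,
        SatIn B S v φ' ↔ SatIn B S v φ ∧ SatIn B S v δ) ∧
    (∀ φ δ, IsPi k φ → IsDelta0 δ → ∃ φ', IsPi k φ' ∧
      ∀ (N : Type) (B : ArithStr N) S, S.Nonempty → ∀ v,
        SatIn B S v φ' ↔ SatIn B S v φ ∧ SatIn B S v δ) := by
  induction k with
  | zero => exact ⟨fun φ δ h hδ => ⟨φ.and δ, IsDelta0.and h hδ, fun _ _ _ _ _ => Iff.rfl⟩,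
      fun φ δ h hδ => ⟨φ.and δ, IsDelta0.and h hδ, fun _ _ _ _ _ => Iff.rfl⟩⟩
  | succ k ih =>
    have shift : ∀ (N : Type) (a : N) v, vcons a v ∘ Nat.succ = v := fun _ _ _ => rfl
    constructor
    · rintro _ δ ⟨i, ψ, hψ, rfl⟩ hδ
      obtain ⟨χ, hχ, e⟩ := ih.2 (ψ.rename fun j => if j = i then 0 else j + 1)
        (δ.rename Nat.succ) (IsPi.rename hψ _) (hδ.rename _)
      obtain ⟨φ', hφ', e'⟩ := hχ.exists_ex
      refine ⟨φ', hφ', fun N B S hS v => ?_⟩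
      simp only [e', e N B S hS, satIn_rename, vcons_comp_eq_update, shift, SatIn]
      exact ⟨fun ⟨a, ha, h₁, h₂⟩ => ⟨⟨a, ha, h₁⟩, h₂⟩, fun ⟨⟨a, ha, h₁⟩, h₂⟩ => ⟨a, ha, h₁, h₂⟩⟩
    · rintro _ δ ⟨i, ψ, hψ, rfl⟩ hδ
      obtain ⟨χ, hχ, e⟩ := ih.1 (ψ.rename fun j => if j = i then 0 else j + 1)
        (δ.rename Nat.succ) (IsSigma.rename hψ _) (hδ.rename _)
      obtain ⟨φ', hφ', e'⟩ := hχ.exists_all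
      refine ⟨φ', hφ', fun N B S hS v => ?_⟩
      simp only [e', e N B S hS, satIn_rename, vcons_comp_eq_update, shift, SatIn]
      obtain ⟨b, hb⟩ := hS
      exact ⟨fun h => ⟨fun a ha => (h a ha).1, (h b hb).2⟩, fun h a ha => ⟨h.1 a ha, h.2⟩⟩

theorem IsDelta0.exists_unpair {φ : Fml} (hφ : IsDelta0 φ) :
    ∃ φ', IsDelta0 φ' ∧ ∀ (N : Type) (B : ArithStr N) S, IsCut B S →
      ∀ z ∈ S, ∀ v : ℕ → N, (SatIn B S (vcons z v) φ' ↔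
        ∃ x ∈ S, ∃ y ∈ S, z = pairing B x y ∧ SatIn B S (vcons x (vcons y v)) φ) := by
  set I := φ.bd + 1 with hI
  let ρ : ℕ → ℕ
    | 0 => I
    | 1 => I + 1
    | k + 2 => k + 1
  let s : Tm := (Tm.var I).add (Tm.var (I + 1))
  let t : Tm := (Tm.var 0).add Tm.one
  have ht : ∀ j, 0 < j → j ∉ t.fv := by
    rintro j hj (e | e)
    · exact hj.ne' e
    · exact e
  refine ⟨Fml.ex I ((Fml.lt (Tm.var I) t).and
      (Fml.ex (I + 1) ((Fml.lt (Tm.var (I + 1)) t).and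
        ((Fml.eq (Tm.var 0) ((s.mul s).add (Tm.var I))).and (φ.rename ρ))))),
    .bex (ht _ (by omega)) (.bex (ht _ (by omega)) (.and (.eq _ _) (hφ.rename ρ))), ?_⟩
  intro N B S hS z hz v
  have key : ∀ x y, SatIn B S (Function.update (Function.update (vcons z v) I x) (I + 1) y ∘ ρ) φ ↔
      SatIn B S (vcons x (vcons y v)) φ := by
    intro x y
    refine satIn_congr B S φ fun k hk => ?_
    rcases k with _ | _ | k
    · simp [ρ]
    · simp [ρ]
    · simp only [Function.comp, ρ]
      rw [Function.update_of_ne (by omega), Function.update_of_ne (by omega)]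
      rfl
  have h₁ : (0 : ℕ) ≠ I := by omega
  have h₂ : (0 : ℕ) ≠ I + 1 := by omega
  have h₃ : I ≠ I + 1 := by omega
  simp only [SatIn, satIn_rename, key, s, t, Tm.val, Function.update_self,
    Function.update_of_ne h₁, Function.update_of_ne h₂, Function.update_of_ne h₃, vcons_zero]
  constructor
  · rintro ⟨x, hx, -, y, hy, -, e, h⟩
    exact ⟨x, hx, y, hy, e, h⟩
  · rintro ⟨x, hx, y, hy, e, h⟩
    obtain ⟨hxz, hyz⟩ := hS.sat.le_pairing x y
    rw [← e] at hxz hyz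
    exact ⟨x, hx, hS.sat.lt_add_one_of_le hxz, y, hy, hS.sat.lt_add_one_of_le hyz, e, h⟩

theorem exists_unpair (k : ℕ) :
    (∀ φ, IsSigma k φ → ∃ φ', IsSigma k φ' ∧ ∀ (N : Type) (B : ArithStr N) S, IsCut B S →
      ∀ z ∈ S, ∀ v : ℕ → N, (SatIn B S (vcons z v) φ' ↔
        ∃ x ∈ S, ∃ y ∈ S, z = pairing B x y ∧ SatIn B S (vcons x (vcons y v)) φ)) ∧
    (∀ φ, IsPi k φ → ∃ φ', IsPi k φ' ∧ ∀ (N : Type) (B : ArithStr N) S, IsCut B S →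
      ∀ z ∈ S, ∀ v : ℕ → N, (SatIn B S (vcons z v) φ' ↔
        ∃ x ∈ S, ∃ y ∈ S, z = pairing B x y ∧ SatIn B S (vcons x (vcons y v)) φ)) := by
  induction k with
  | zero => exact ⟨fun _ h => IsDelta0.exists_unpair h, fun _ h => IsDelta0.exists_unpair h⟩
  | succ k ih =>
    let swap : ℕ → ℕ
      | 0 => 1
      | 1 => 0
      | k + 2 => k + 2
    let pull : ℕ → ℕ → ℕ := fun i j =>
      if j = i then 2 else match j with
        | 0 => 0
        | 1 => 1
        | j + 2 => j + 3
    have hswap : ∀ (N : Type) (a z : N) v,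
        vcons a (vcons z v) ∘ swap = vcons z (vcons a v) := fun N a z v => by
      funext j
      rcases j with _ | _ | j <;> rfl
    have hpull : ∀ (N : Type) (x y a : N) v i, vcons x (vcons y (vcons a v)) ∘ pull i =
        Function.update (vcons x (vcons y v)) i a := fun N x y a v i => by
      funext j
      by_cases hj : j = i
      · subst hj; simp [pull]
      · rcases j with _ | _ | j <;> simp [pull, hj]
    constructor
    · rintro _ ⟨i, ψ, hψ, rfl⟩
      obtain ⟨χ, hχ, e⟩ := ih.2 (ψ.rename (pull i)) (IsPi.rename hψ _)
      obtain ⟨φ', hφ', e'⟩ := (hχ.rename swap).exists_ex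
      refine ⟨φ', hφ', fun N B S hS z hz v => ?_⟩
      simp only [e', satIn_rename, hswap, e N B S hS z hz, hpull, SatIn]
      exact ⟨fun ⟨a, ha, x, hx, y, hy, hp, h⟩ => ⟨x, hx, y, hy, hp, a, ha, h⟩,
        fun ⟨x, hx, y, hy, hp, a, ha, h⟩ => ⟨a, ha, x, hx, y, hy, hp, h⟩⟩
    · rintro _ ⟨i, ψ, hψ, rfl⟩
      obtain ⟨χ, hχ, e⟩ := ih.1 (ψ.rename (pull i)) (IsSigma.rename hψ _)
      obtain ⟨φ', hφ', e'⟩ := (hχ.rename swap).exists_all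
      refine ⟨φ', hφ', fun N B S hS z hz v => ?_⟩
      simp only [e', satIn_rename, hswap, e N B S hS z hz, hpull, SatIn]
      constructor
      · intro H
        obtain ⟨x, hx, y, hy, hp, -⟩ := H _ hS.zero_mem
        refine ⟨x, hx, y, hy, hp, fun a ha => ?_⟩
        obtain ⟨x', -, y', -, hp', h⟩ := H a ha
        obtain ⟨rfl, rfl⟩ := hS.sat.pairing_inj (hp.symm.trans hp')
        exact h
      · rintro ⟨x, hx, y, hy, hp, H⟩ a ha
        exact ⟨x, hx, y, hy, hp, H a ha⟩

/-- Replace the first `b` values of the valuation `v`, shifting `v` by `b`. -/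
def vapp (b : ℕ) (u v : ℕ → N) : ℕ → N := fun j => if j < b then u j else v (j - b)

theorem vapp_of_lt {b j : ℕ} (h : j < b) (u v : ℕ → N) : vapp b u v j = u j := if_pos h

theorem vapp_add (b j : ℕ) (u v : ℕ → N) : vapp b u v (b + j) = v j := by
  simp [vapp]

theorem vapp_zero (u v : ℕ → N) : vapp 0 u v = v := by
  funext j
  simp [vapp]

theorem vapp_succ (b : ℕ) (u v : ℕ → N) : vapp (b + 1) u v = vapp b u (vcons (u b) v) := by
  funext j
  rcases lt_trichotomy j b with h | rfl | h
  · simp [vapp, h, h.trans (Nat.lt_succ_self b)]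
  · simp [vapp]
  · obtain ⟨c, rfl⟩ : ∃ c, j = b + 1 + c := ⟨j - (b + 1), by omega⟩
    rw [vapp_add, add_assoc, vapp_add, add_comm 1 c]
    rfl

theorem vapp_congr {b : ℕ} {u u' : ℕ → N} (h : ∀ j < b, u j = u' j) (v : ℕ → N) :
    vapp b u v = vapp b u' v := by
  funext j
  by_cases hj : j < b
  · simp [vapp, hj, h j hj]
  · simp [vapp, hj]

theorem vapp_update_left {b i : ℕ} (hi : i < b) (u v : ℕ → N) (a : N) :
    vapp b (Function.update u i a) v = Function.update (vapp b u v) i a := by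
  funext j
  by_cases hj : j = i
  · subst hj; simp [vapp, hi]
  · simp [vapp, hj]

/-- A code for the first `b` values of a valuation. -/
def code (B : ArithStr N) : ℕ → (ℕ → N) → N
  | 0, _ => B.zero
  | b + 1, u => pairing B (code B b u) (u b)

theorem IsCut.code_mem {B : ArithStr N} {S : Set N} (hS : IsCut B S) (b : ℕ) {u : ℕ → N}
    (hu : ∀ k, u k ∈ S) : code B b u ∈ S := by
  induction b with
  | zero => exact hS.zero_mem
  | succ b ih => exact hS.pairing_mem ih (hu b)

theorem SatPAminus.exists_code_lt {B : ArithStr N} (h : SatPAminus B) (b : ℕ) (p : N) :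
    ∃ q, ∀ u, (∀ j < b, B.lt (u j) p) → B.lt (code B b u) q := by
  induction b with
  | zero =>
    obtain ⟨q, hq, -⟩ := h.exists_gt₂ B.zero B.zero
    exact ⟨q, fun _ _ => hq⟩
  | succ b ih =>
    obtain ⟨q, hq⟩ := ih
    exact ⟨pairing B q p, fun u hu => h.pairing_lt
      (hq u fun j hj => hu j (hj.trans (Nat.lt_succ_self b))) (hu b (Nat.lt_succ_self b))⟩

theorem IsPi.exists_decode {k : ℕ} {φ : Fml} (hφ : IsPi k φ) (b : ℕ) :
    ∃ φ', IsPi k φ' ∧ ∀ (N : Type) (B : ArithStr N) S, IsCut B S → ∀ v : ℕ → N, (∀ k, v k ∈ S) →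
      (∀ u, (∀ k, u k ∈ S) →
        (SatIn B S (vcons (code B b u) v) φ' ↔ SatIn B S (vapp b u v) φ)) ∧
      (∀ z ∈ S, SatIn B S (vcons z v) φ' →
        ∃ u, (∀ k, u k ∈ S) ∧ SatIn B S (vapp b u v) φ) := by
  induction b with
  | zero =>
    refine ⟨φ.rename Nat.succ, hφ.rename _, fun N B S hS v hv => ⟨fun u hu => ?_, fun z hz h => ?_⟩⟩
    · rw [satIn_rename, vapp_zero]; rfl
    · rw [satIn_rename] at h
      exact ⟨v, hv, by rw [vapp_zero]; exact h⟩
  | succ b ih =>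
    obtain ⟨χ, hχ, e⟩ := ih
    obtain ⟨φ', hφ', e'⟩ := (exists_unpair k).2 χ hχ
    refine ⟨φ', hφ', fun N B S hS v hv => ⟨fun u hu => ?_, fun z hz h => ?_⟩⟩
    · rw [e' N B S hS _ (hS.code_mem _ hu), vapp_succ,
        ← (e N B S hS _ (vcons_mem (hu b) hv)).1 u hu]
      constructor
      · rintro ⟨x, -, y, -, hp, h⟩
        obtain ⟨rfl, rfl⟩ := hS.sat.pairing_inj hp
        exact h
      · exact fun h => ⟨_, hS.code_mem b hu, _, hu b, rfl, h⟩
    · obtain ⟨x, hx, y, hy, -, h'⟩ := (e' N B S hS z hz v).1 h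
      obtain ⟨u, hu, hs⟩ := (e N B S hS _ (vcons_mem hy hv)).2 x hx h'
      refine ⟨Function.update u b y, update_mem hu b hy, ?_⟩
      rw [vapp_succ, Function.update_self,
        vapp_congr (fun j hj => Function.update_of_ne hj.ne _ _)]
      exact hs

theorem IsPi.exists_block {k : ℕ} {φ : Fml} (hφ : IsPi k φ) (b : ℕ) :
    ∃ φ', IsSigma (k + 1) φ' ∧ ∀ (N : Type) (B : ArithStr N) S, IsCut B S →
      ∀ v : ℕ → N, (∀ k, v k ∈ S) →
        (SatIn B S v φ' ↔ ∃ u, (∀ k, u k ∈ S) ∧ SatIn B S (vapp b u v) φ) := by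
  obtain ⟨χ, hχ, e⟩ := hφ.exists_decode b
  obtain ⟨φ', hφ', e'⟩ := hχ.exists_ex
  refine ⟨φ', hφ', fun N B S hS v hv => ?_⟩
  rw [e']
  constructor
  · rintro ⟨z, hz, h⟩
    exact (e N B S hS v hv).2 z hz h
  · rintro ⟨u, hu, h⟩
    exact ⟨_, hS.code_mem b hu, ((e N B S hS v hv).1 u hu).2 h⟩

/-! ### Strong collection implies elementarity of the supremum -/

theorem sat_ex (B : ArithStr N) (v : ℕ → N) (i : ℕ) (ψ : Fml) :
    Sat B v (Fml.ex i ψ) ↔ ∃ y, Sat B (Function.update v i y) ψ := by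
  simp [Sat, SatIn]

theorem SigmaElemEmb.transfer_block {n : ℕ} {A : ArithStr M} {B : ArithStr N} {f : M → N}
    (hA : SatPAminus A) (hB : SatPAminus B) (hs : SigmaElemEmb (n + 1) A B f) {φ : Fml}
    (hφ : IsPi n φ) (b : ℕ) (w : ℕ → M) {u : ℕ → N} (hu : Sat B (vapp b u (f ∘ w)) φ) :
    ∃ u, Sat A (vapp b u w) φ := by
  obtain ⟨χ, hχ, e⟩ := hφ.exists_block b
  have h₁ := (e N B _ (isCut_univ hB) (f ∘ w) fun _ => trivial).2 ⟨u, fun _ => trivial, hu⟩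
  obtain ⟨u', -, h₂⟩ := (e M A _ (isCut_univ hA) w fun _ => trivial).1 ((hs χ hχ w).2 h₁)
  exact ⟨u', h₂⟩

theorem CollSScheme.exists_bound {n : ℕ} {A : ArithStr M} (hA : SatPAminus A)
    (hc : CollSScheme A (IsSigma (n + 1))) {ψ : Fml} (hψ : IsPi n ψ) (b : ℕ) (p : M) :
    ∃ q, ∀ v : ℕ → M, (∀ j < b, A.lt (v j) p) → ∀ y, Sat A (vapp b v fun _ => y) ψ →
      ∃ y, A.lt y q ∧ Sat A (vapp b v fun _ => y) ψ := by
  obtain ⟨χ, hχ, e⟩ := hψ.exists_decode b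
  set θ := χ.rename (fun j => min j 1) with hθ
  have hfv : (Fml.ex θ.bd θ).fv ⊆ {0, 1, 2} := by
    refine Set.sdiff_subset.trans (Fml.fv_rename_subset fun k => ?_)
    rcases k with _ | k <;> simp
  have hval : ∀ x y v : M, val3 x y v ∘ (fun j => min j 1) = vcons x fun _ => y := by
    intro x y v
    funext j
    rcases j with _ | j <;> simp [val3]
  have key : ∀ u y v, Sat A (val3 (code A b u) y v) (Fml.ex θ.bd θ) ↔
      Sat A (vapp b u fun _ => y) ψ := by
    intro u y v
    unfold Sat
    rw [satIn_ex_bd A (S := Set.univ) ⟨A.zero, trivial⟩, hθ, satIn_rename, hval,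
      (e M A _ (isCut_univ hA) _ fun _ => trivial).1 u fun _ => trivial]
  obtain ⟨P, hP⟩ := hA.exists_code_lt b p
  obtain ⟨q, hq⟩ := hc _ ((hχ.rename _).ex _) hfv A.zero P
  refine ⟨q, fun v hv y hy => ?_⟩
  obtain ⟨y', hy', h⟩ := (hq _ (hP v hv)).1 ⟨y, (key v y _).2 hy⟩
  exact ⟨y', hy', (key v y' _).1 h⟩

/-- On tuples of length `b` bounded by `p`, the formula `φ` is equivalent, in both structures,
to a single Δ₀ formula with parameters from `M`. -/
def BoundedApprox (A : ArithStr M) (B : ArithStr N) (f : M → N) (b : ℕ) (p : M) (φ : Fml) : Prop :=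
  ∃ δ w, IsDelta0 δ ∧
    (∀ v : ℕ → M, (∀ j < b, A.lt (v j) p) → (Sat A v φ ↔ Sat A (vapp b v w) δ)) ∧
    (∀ v : ℕ → N, (∀ j < b, B.lt (v j) (f p)) → (Sat B v φ ↔ Sat B (vapp b v (f ∘ w)) δ))

/-- The formula stating that the first `b` variables are below `t`. -/
def allLt (t : Tm) : ℕ → Fml
  | 0 => Fml.eq Tm.zero Tm.zero
  | b + 1 => (allLt t b).and (Fml.lt (Tm.var b) t)

theorem isDelta0_allLt (t : Tm) (b : ℕ) : IsDelta0 (allLt t b) := by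
  induction b with
  | zero => exact .eq _ _
  | succ b ih => exact .and ih (.lt _ _)

theorem satIn_allLt (B : ArithStr N) (S : Set N) (t : Tm) (b : ℕ) (v : ℕ → N) :
    SatIn B S v (allLt t b) ↔ ∀ j < b, B.lt (v j) (t.val B v) := by
  induction b with
  | zero => simp [allLt, SatIn]
  | succ b ih =>
    simp only [allLt, SatIn, ih, Tm.val]
    refine ⟨fun h j hj => ?_, fun h => ⟨fun j hj => h j (by omega), h b (by omega)⟩⟩
    rcases Nat.lt_succ_iff_lt_or_eq.1 hj with hj | rfl
    · exact h.1 j hj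
    · exact h.2

theorem update_bounded {B : ArithStr N} {v : ℕ → N} {b i : ℕ} {p a : N}
    (hv : ∀ j < b, B.lt (v j) p) (ha : B.lt a p) :
    ∀ j < b, B.lt (Function.update v i a j) p := by
  intro j hj
  by_cases hji : j = i
  · subst hji; simpa using ha
  · rw [Function.update_of_ne hji]; exact hv j hj

theorem CollSScheme.boundedApprox_ex {n : ℕ} {A : ArithStr M} {B : ArithStr N} {f : M → N}
    (hA : SatPAminus A) (hc : CollSScheme A (IsSigma (n + 1))) (hB : SatPAminus B)
    (hf : ArithEmb A B f) (hs : SigmaElemEmb (n + 1) A B f) {k : ℕ} (hkn : k ≤ n) {ψ : Fml}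
    (hψ : IsPi k ψ) {b i : ℕ} (hi : i < b) (hb : ψ.bd ≤ b)
    (ih : ∀ p, BoundedApprox A B f b p ψ) (p : M) :
    BoundedApprox A B f b p (Fml.ex i ψ) ∧
      ∃ q, ∀ v : ℕ → N, (∀ j < b, B.lt (v j) (f p)) → Sat B v (Fml.ex i ψ) →
        ∃ y, B.lt y (f q) ∧ Sat B (Function.update v i y) ψ := by
  obtain ⟨ψn, hψn, en⟩ := hψ.exists_raise hkn
  set ρ : ℕ → ℕ := fun j => if j = i then b else j with hρ
  have e₀ : ∀ (L : Type) (C : ArithStr L) (v w : ℕ → L) (y : L),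
      Sat C (vapp b v (vcons y w)) (ψn.rename ρ) ↔ Sat C (Function.update v i y) ψ := by
    intro L C v w y
    unfold Sat
    rw [satIn_rename, en L C Set.univ ⟨y, trivial⟩]
    refine satIn_congr C _ ψ fun j hj => ?_
    by_cases hji : j = i
    · subst hji; simp [ρ, vapp]
    · simp [ρ, hji, vapp, hj.trans_le hb]
  obtain ⟨q, hq⟩ := hc.exists_bound hA (hψn.rename ρ) b p
  have hconst : ∀ y : M, (fun _ => y) = vcons y fun _ => y := fun y => by
    funext j; cases j <;> rfl
  have e₀c : ∀ (v : ℕ → M) (y : M), Sat A (vapp b v fun _ => y) (ψn.rename ρ) ↔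
      Sat A (Function.update v i y) ψ := fun v y => by
    have := e₀ M A v (fun _ => y) y
    rwa [← hconst y] at this
  simp only [e₀c] at hq
  obtain ⟨r, hpr, hqr⟩ := hA.exists_gt₂ p q
  obtain ⟨δ, w, hδ, hδA, hδB⟩ := ih r
  set c := b + δ.bd with hcb
  set δ' := Fml.ex i ((Fml.lt (Tm.var i) (Tm.var c)).and δ) with hδ'
  have hδ'₀ : IsDelta0 δ' := .bex (by simp only [Tm.fv, Set.mem_singleton_iff]; omega) hδ
  have e₁ : ∀ (L : Type) (C : ArithStr L) (v W : ℕ → L) (Q : L),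
      Sat C (vapp b v (Function.update W δ.bd Q)) δ' ↔
        ∃ a, C.lt a Q ∧ Sat C (vapp b (Function.update v i a) W) δ := by
    intro L C v W Q
    rw [hδ', sat_ex]
    refine exists_congr fun a => and_congr ?_ ?_
    · simp only [SatIn, Tm.val, Function.update_self]
      rw [Function.update_of_ne (by omega), hcb, vapp_add, Function.update_self]
    · rw [← vapp_update_left hi]
      refine satIn_congr C _ δ fun j hj => ?_
      unfold vapp
      split_ifs
      · rfl
      · exact Function.update_of_ne (by omega) _ _
  set w' := Function.update w δ.bd q with hw'
  have hfw' : f ∘ w' = Function.update (f ∘ w) δ.bd (f q) := Function.comp_update f w δ.bd q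
  have lt_map : ∀ {x y : M}, A.lt x y → B.lt (f x) (f y) := (hf.2.2.2.2.2 _ _).1
  have hM : ∀ v : ℕ → M, (∀ j < b, A.lt (v j) p) →
      (Sat A v (Fml.ex i ψ) ↔ Sat A (vapp b v w') δ') := by
    intro v hv
    rw [hw', e₁, sat_ex]
    have hb' : ∀ a, A.lt a q → ∀ j < b, A.lt (Function.update v i a j) r := fun a ha =>
      update_bounded (fun j hj => hA.lt_trans (hv j hj) hpr) (hA.lt_trans ha hqr)
    constructor
    · rintro ⟨y, hy⟩
      obtain ⟨a, ha, h⟩ := hq v hv y hy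
      exact ⟨a, ha, (hδA _ (hb' a ha)).1 h⟩
    · rintro ⟨a, ha, h⟩
      exact ⟨a, (hδA _ (hb' a ha)).2 h⟩
  have hN : ∀ v : ℕ → N, (∀ j < b, B.lt (v j) (f p)) →
      (Sat B (vapp b v (f ∘ w')) δ' ↔
        ∃ y, B.lt y (f q) ∧ Sat B (Function.update v i y) ψ) := by
    intro v hv
    rw [hfw', e₁]
    refine exists_congr fun a => and_congr_right fun ha => (hδB _ ?_).symm
    exact update_bounded (fun j hj => hB.lt_trans (hv j hj) (lt_map hpr))
      (hB.lt_trans ha (lt_map hqr))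
  obtain ⟨Ξ, hΞ, eΞ⟩ := (exists_and_delta0 n).2 (ψn.rename ρ)
    ((allLt (Tm.var (b + 1)) b).and (δ'.rename fun j => if j < b then j else j + 2).not)
    (hψn.rename ρ) (.and (isDelta0_allLt _ _) (.not (hδ'₀.rename _)))
  have e₂ : ∀ (L : Type) (C : ArithStr L) (u W : ℕ → L) (P : L),
      Sat C (vapp (b + 1) u (vcons P W)) Ξ ↔ Sat C (Function.update u i (u b)) ψ ∧
        (∀ j < b, C.lt (u j) P) ∧ ¬ Sat C (vapp b u W) δ' := by
    intro L C u W P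
    unfold Sat
    rw [eΞ L C Set.univ ⟨P, trivial⟩]
    simp only [SatIn, satIn_allLt, satIn_rename, Tm.val]
    refine and_congr ?_ (and_congr (forall₂_congr fun j hj => ?_) (not_congr ?_))
    · rw [vapp_succ]
      have := e₀ L C u (vcons P W) (u b)
      unfold Sat at this
      rwa [satIn_rename] at this
    · rw [vapp_of_lt (by omega), show vapp (b + 1) u (vcons P W) (b + 1) = P from
        vapp_add (b + 1) 0 u (vcons P W)]
    · refine iff_of_eq (congrArg (fun v => SatIn C Set.univ v δ') ?_)
      funext j
      by_cases hj : j < b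
      · simp [vapp, hj, hj.trans (Nat.lt_succ_self b)]
      · obtain ⟨d, rfl⟩ : ∃ d, j = b + d := ⟨j - b, by omega⟩
        rw [vapp_add]
        simp only [Function.comp, if_neg hj]
        rw [show b + d + 2 = b + 1 + (d + 1) by omega, vapp_add]
        rfl
  have hbound : ∀ v : ℕ → N, (∀ j < b, B.lt (v j) (f p)) → Sat B v (Fml.ex i ψ) →
      ∃ y, B.lt y (f q) ∧ Sat B (Function.update v i y) ψ := by
    intro v hv hex
    rw [← hN v hv]
    by_contra hnot
    obtain ⟨y, hy⟩ := (sat_ex _ _ _ _).1 hex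
    have hlt : ∀ j < b, Function.update v b y j = v j := fun j hj =>
      Function.update_of_ne hj.ne _ _
    have hΞB : Sat B (vapp (b + 1) (Function.update v b y) (f ∘ vcons p w')) Ξ := by
      rw [comp_vcons, e₂]
      refine ⟨?_, fun j hj => by rw [hlt j hj]; exact hv j hj, by rwa [vapp_congr hlt]⟩
      refine (satIn_congr B _ ψ fun j hj => ?_).1 hy
      by_cases hji : j = i
      · subst hji; simp
      · simp [Function.update_of_ne hji, hlt j (hj.trans_le hb)]
    obtain ⟨u, hu⟩ := hs.transfer_block hA hB hΞ (b + 1) (vcons p w') hΞB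
    obtain ⟨h₁, h₂, h₃⟩ := (e₂ M A u w' p).1 hu
    exact h₃ ((hM u h₂).1 ((sat_ex _ _ _ _).2 ⟨_, h₁⟩))
  refine ⟨⟨δ', w', hδ'₀, hM, fun v hv => ?_⟩, q, hbound⟩
  rw [hN v hv]
  exact ⟨hbound v hv, fun ⟨y, _, h⟩ => (sat_ex _ _ _ _).2 ⟨y, h⟩⟩

theorem BoundedApprox.of_not {A : ArithStr M} {B : ArithStr N} {f : M → N} {b : ℕ} {p : M}
    {φ φ' : Fml} (h : BoundedApprox A B f b p φ')
    (e : ∀ (N : Type) (B : ArithStr N) S v, SatIn B S v φ' ↔ ¬ SatIn B S v φ) :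
    BoundedApprox A B f b p φ := by
  obtain ⟨δ, w, hδ, h₁, h₂⟩ := h
  refine ⟨δ.not, w, hδ.not, fun v hv => ?_, fun v hv => ?_⟩
  · have := h₁ v hv
    simp only [Sat, SatIn, e] at this ⊢
    exact not_iff_comm.1 this |>.symm
  · have := h₂ v hv
    simp only [Sat, SatIn, e] at this ⊢
    exact not_iff_comm.1 this |>.symm

theorem CollSScheme.boundedApprox {n : ℕ} {A : ArithStr M} {B : ArithStr N} {f : M → N}
    (hA : SatPAminus A) (hc : CollSScheme A (IsSigma (n + 1))) (hB : SatPAminus B)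
    (hf : ArithEmb A B f) (hs : SigmaElemEmb (n + 1) A B f) {k : ℕ} (hkn : k ≤ n + 1) {φ : Fml}
    (hφ : IsSigma k φ) {b : ℕ} (hb : φ.bd ≤ b) (p : M) : BoundedApprox A B f b p φ := by
  induction k generalizing φ p with
  | zero =>
    have e : ∀ (L : Type) (C : ArithStr L) (v w : ℕ → L), Sat C v φ ↔ Sat C (vapp b v w) φ :=
      fun L C v w => satIn_congr C _ φ fun j hj => (vapp_of_lt (hj.trans_le hb) v w).symm
    exact ⟨φ, fun _ => p, hφ, fun v _ => e M A v _, fun v _ => e N B v _⟩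
  | succ k ih =>
    obtain ⟨i, ψ, hψ, rfl⟩ := hφ
    obtain ⟨ψ', hψ', hbd, e⟩ := (exists_negation k).2 ψ hψ
    have hψb : ψ.bd ≤ b := (le_max_right _ _).trans hb
    have hi : i < b := (le_max_left _ _).trans hb
    exact (hc.boundedApprox_ex hA hB hf hs (by omega) hψ hi hψb
      (fun p => (ih (by omega) hψ' (hbd ▸ hψb) p).of_not e) p).1

theorem CollSScheme.satIn_supSet_iff {n : ℕ} {A : ArithStr M} {B : ArithStr N} {f : M → N}
    (hA : SatPAminus A) (hc : CollSScheme A (IsSigma (n + 1))) (hB : SatPAminus B)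
    (hf : ArithEmb A B f) (hs : SigmaElemEmb (n + 1) A B f) {k : ℕ} (hkn : k ≤ n + 1) {φ : Fml}
    (hφ : IsSigma k φ) {v : ℕ → N} (hv : ∀ k, v k ∈ supSet B f) :
    SatIn B (supSet B f) v φ ↔ Sat B v φ := by
  have hcut := isCut_supSet hB hf
  induction k generalizing φ v with
  | zero => exact IsDelta0.satIn_iff hcut hφ hv
  | succ k ih =>
    obtain ⟨i, ψ, hψ, rfl⟩ := hφ
    obtain ⟨ψ', hψ', hbd, e⟩ := (exists_negation k).2 ψ hψ
    have ih' : ∀ {v : ℕ → N}, (∀ k, v k ∈ supSet B f) →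
        (SatIn B (supSet B f) v ψ ↔ Sat B v ψ) := fun {v} hv => by
      have := ih (by omega) hψ' hv
      simp only [Sat, e] at this ⊢
      exact not_iff_not.1 this
    rw [sat_ex]
    constructor
    · rintro ⟨a, ha, h⟩
      exact ⟨a, (ih' (update_mem hv i ha)).1 h⟩
    · intro hex
      set b := max (i + 1) ψ.bd with hb
      have hvS := hv
      choose m hm using hv
      obtain ⟨p, hp⟩ := hA.exists_bound b m
      obtain ⟨-, q, hq⟩ := hc.boundedApprox_ex hA hB hf hs (by omega) hψ
        (show i < b by omega) (show ψ.bd ≤ b by omega)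
        (fun p => (hc.boundedApprox hA hB hf hs (by omega) hψ'
          (show ψ'.bd ≤ b by omega) p).of_not e) p
      obtain ⟨y, hy, h⟩ := hq v
        (fun j hj => hB.lt_trans (hm j) ((hf.2.2.2.2.2 _ _).1 (hp j hj))) ((sat_ex _ _ _ _).2 hex)
      have hyS : y ∈ supSet B f := ⟨q, hy⟩
      exact ⟨y, hyS, (ih' (update_mem hvS i hyS)).2 h⟩

/-! ### Ultrapowers -/

/-- The ultrapower of a structure. -/
def ultrapower (A : ArithStr M) {I : Type} (U : Ultrafilter I) :
    ArithStr ((U : Filter I).Germ M) where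
  zero := Filter.Germ.const A.zero
  one := Filter.Germ.const A.one
  add := Filter.Germ.map₂ A.add
  mul := Filter.Germ.map₂ A.mul
  lt := Filter.Germ.LiftRel A.lt

theorem Tm.val_ultrapower (A : ArithStr M) {I : Type} (U : Ultrafilter I) (v : ℕ → I → M)
    (t : Tm) : t.val (ultrapower A U) (fun k => (v k : (U : Filter I).Germ M)) =
      ((fun i => t.val A fun k => v k i : I → M) : (U : Filter I).Germ M) := by
  induction t with
  | var i => rfl
  | zero => rfl
  | one => rfl
  | add s t ihs iht | mul s t ihs iht => simp only [Tm.val, ihs, iht]; rfl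

theorem sat_ultrapower (A : ArithStr M) {I : Type} (U : Ultrafilter I) (v : ℕ → I → M)
    (φ : Fml) : Sat (ultrapower A U) (fun k => (v k : (U : Filter I).Germ M)) φ ↔
      ∀ᶠ i in U, Sat A (fun k => v k i) φ := by
  have hup : ∀ (v : ℕ → I → M) j (g : I → M),
      Function.update (fun k => (v k : (U : Filter I).Germ M)) j (g : (U : Filter I).Germ M) =
        fun k => ((Function.update v j g k : I → M) : (U : Filter I).Germ M) := fun v j g => by
    funext k
    by_cases hk : k = j
    · subst hk; simp
    · simp [hk]
  have hup' : ∀ (v : ℕ → I → M) j (g : I → M) i,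
      (fun k => Function.update v j g k i) = Function.update (fun k => v k i) j (g i) :=
    fun v j g i => by
      funext k
      by_cases hk : k = j
      · subst hk; simp
      · simp [hk]
  have hex : ∀ (v : ℕ → I → M) j (P : (ℕ → M) → Prop),
      (∃ g : I → M, ∀ᶠ i in U, P fun k => Function.update v j g k i) ↔
        ∀ᶠ i in U, ∃ a, P (Function.update (fun k => v k i) j a) := by
    intro v j P
    simp only [hup']
    constructor
    · rintro ⟨g, hg⟩
      exact hg.mono fun i hi => ⟨_, hi⟩
    · intro h
      obtain ⟨g, hg⟩ := h.choice
      exact ⟨g, hg⟩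
  unfold Sat
  induction φ generalizing v with
  | lt s t => simp only [SatIn, Tm.val_ultrapower]; rfl
  | eq s t => simp only [SatIn, Tm.val_ultrapower]; exact Filter.Germ.coe_eq
  | not φ ih => simp only [SatIn, ih, Ultrafilter.eventually_not]
  | and φ ψ ih₁ ih₂ => simp only [SatIn, ih₁, ih₂, Filter.eventually_and]
  | or φ ψ ih₁ ih₂ => simp only [SatIn, ih₁, ih₂, Ultrafilter.eventually_or]
  | imp φ ψ ih₁ ih₂ => simp only [SatIn, ih₁, ih₂, Ultrafilter.eventually_imp]
  | ex j φ ih =>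
    simp only [SatIn, Set.mem_univ, true_and]
    rw [← hex v j fun w => SatIn A Set.univ w φ]
    constructor
    · rintro ⟨a, ha⟩
      induction a using Filter.Germ.inductionOn with | _ g
      rw [hup] at ha
      exact ⟨g, (ih _).1 ha⟩
    · rintro ⟨g, hg⟩
      exact ⟨g, by rw [hup]; exact (ih _).2 hg⟩
  | all j φ ih =>
    simp only [SatIn, Set.mem_univ, true_imp_iff]
    rw [← not_iff_not, ← Ultrafilter.eventually_not]
    simp only [not_forall]
    rw [← hex v j fun w => ¬ SatIn A Set.univ w φ]
    constructor
    · rintro ⟨a, ha⟩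
      induction a using Filter.Germ.inductionOn with | _ g
      rw [hup] at ha
      exact ⟨g, Ultrafilter.eventually_not.2 fun h => ha ((ih _).2 h)⟩
    · rintro ⟨g, hg⟩
      exact ⟨g, by rw [hup]; exact fun h => Ultrafilter.eventually_not.1 hg ((ih _).1 h)⟩

theorem SatPAminus.ultrapower {A : ArithStr M} (h : SatPAminus A) {I : Type}
    (U : Ultrafilter I) : SatPAminus (ultrapower A U) := by
  obtain ⟨h1, h2, h3, h4, h5, h6, h7, h8, h9, h10, h11, h12, h13, h14, ⟨h15, h15'⟩, h16⟩ := h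
  refine ⟨?_, ?_, ?_, ?_, ?_, ?_, ?_, ?_, ?_, ?_, ?_, ?_, ?_, ?_, ⟨?_, ?_⟩, ?_⟩
  · rintro ⟨x⟩ ⟨y⟩ ⟨z⟩
    exact Filter.Germ.coe_eq.2 (.of_forall fun i => h1 _ _ _)
  · rintro ⟨x⟩ ⟨y⟩
    exact Filter.Germ.coe_eq.2 (.of_forall fun i => h2 _ _)
  · rintro ⟨x⟩ ⟨y⟩ ⟨z⟩
    exact Filter.Germ.coe_eq.2 (.of_forall fun i => h3 _ _ _)
  · rintro ⟨x⟩ ⟨y⟩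
    exact Filter.Germ.coe_eq.2 (.of_forall fun i => h4 _ _)
  · rintro ⟨x⟩ ⟨y⟩ ⟨z⟩
    exact Filter.Germ.coe_eq.2 (.of_forall fun i => h5 _ _ _)
  · rintro ⟨x⟩
    exact Filter.Germ.coe_eq.2 (.of_forall fun i => h6 _)
  · rintro ⟨x⟩
    exact Filter.Germ.coe_eq.2 (.of_forall fun i => h7 _)
  · rintro ⟨x⟩
    exact Filter.Germ.coe_eq.2 (.of_forall fun i => h8 _)
  · rintro ⟨x⟩ ⟨y⟩ ⟨z⟩ hxy hyz
    exact Filter.Germ.liftRel_coe.2 ((Filter.Germ.liftRel_coe.1 hxy).mp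
      ((Filter.Germ.liftRel_coe.1 hyz).mono fun i b a => h9 _ _ _ a b))
  · rintro ⟨x⟩ hx
    obtain ⟨i, hi⟩ := (Filter.Germ.liftRel_coe.1 hx).exists
    exact h10 _ hi
  · rintro ⟨x⟩ ⟨y⟩
    have := (Filter.Eventually.of_forall fun i => h11 (x i) (y i) : ∀ᶠ i in U, _)
    rw [Ultrafilter.eventually_or, Ultrafilter.eventually_or] at this
    exact this.imp Filter.Germ.liftRel_coe.2 (Or.imp Filter.Germ.coe_eq.2 Filter.Germ.liftRel_coe.2)
  · rintro ⟨x⟩ ⟨y⟩ ⟨z⟩ hxy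
    exact Filter.Germ.liftRel_coe.2 ((Filter.Germ.liftRel_coe.1 hxy).mono fun i => h12 _ _ _)
  · rintro ⟨x⟩ ⟨y⟩ ⟨z⟩ hz hxy
    exact Filter.Germ.liftRel_coe.2 ((Filter.Germ.liftRel_coe.1 hz).mp
      ((Filter.Germ.liftRel_coe.1 hxy).mono fun i b a => h13 _ _ _ a b))
  · rintro ⟨x⟩ ⟨y⟩ hxy
    obtain ⟨z, hz⟩ := ((Filter.Germ.liftRel_coe.1 hxy).mono fun i => h14 _ _).choice
    exact ⟨z, Filter.Germ.coe_eq.2 hz⟩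
  · exact Filter.Germ.liftRel_coe.2 (.of_forall fun i => h15)
  · rintro ⟨x⟩ hx
    have := (Filter.Germ.liftRel_coe.1 hx).mono fun i => h15' _
    rw [Ultrafilter.eventually_or] at this
    exact this.imp Filter.Germ.coe_eq.2 Filter.Germ.liftRel_coe.2
  · rintro ⟨x⟩
    have := (Filter.Eventually.of_forall fun i => h16 (x i) : ∀ᶠ i in U, _)
    rw [Ultrafilter.eventually_or] at this
    exact this.imp Filter.Germ.coe_eq.2 Filter.Germ.liftRel_coe.2

/-- The diagonal embedding into the ultrapower. -/
def diag {I : Type} (U : Ultrafilter I) (m : M) : (U : Filter I).Germ M := Filter.Germ.const m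

theorem sat_diag (A : ArithStr M) {I : Type} (U : Ultrafilter I) (v : ℕ → M) (φ : Fml) :
    Sat A v φ ↔ Sat (ultrapower A U) (diag U ∘ v) φ :=
  ((sat_ultrapower A U (fun k _ => v k) φ).trans Filter.eventually_const).symm

theorem arithEmb_diag (A : ArithStr M) {I : Type} (U : Ultrafilter I) :
    ArithEmb A (ultrapower A U) (diag U) :=
  ⟨fun _ _ h => Filter.Germ.const_inj.1 h, rfl, rfl, fun _ _ => rfl, fun _ _ => rfl,
    fun _ _ => Filter.Germ.liftRel_const_iff.symm⟩

theorem SatPAminus.exists_ultrafilter {A : ArithStr M} (h : SatPAminus A) :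
    ∃ U : Ultrafilter M, ∀ q, ∀ᶠ q' in U, A.lt q q' := by
  let := h.linearOrder
  have : Nonempty M := ⟨A.zero⟩
  refine ⟨Ultrafilter.of Filter.atTop, fun q => Ultrafilter.of_le _ ?_⟩
  filter_upwards [Filter.eventually_ge_atTop (A.add q A.one)] with q' hq'
  exact lt_of_lt_of_le (h.lt_add_one q) hq'

/-! ### Elementarity of suprema implies strong collection -/

theorem IsSigma.exists_ex_val3 {n : ℕ} {φ : Fml} (hφ : IsSigma (n + 1) φ) :
    ∃ φ', IsSigma (n + 1) φ' ∧ ∀ (N : Type) (B : ArithStr N) S, IsCut B S →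
      ∀ c ∈ S, ∀ d ∈ S, (SatIn B S (vcons c fun _ => d) φ' ↔
        ∃ y ∈ S, SatIn B S (val3 c y d) φ) := by
  obtain ⟨i, ψ, hψ, rfl⟩ := hφ
  set ρ : ℕ → ℕ := fun j =>
    if j = i then 1 else if j = 0 then 2 else if j = 1 then 0 else 3 with hρ
  obtain ⟨φ', hφ', e⟩ := IsPi.exists_block (IsPi.rename hψ ρ) 2
  have hval : ∀ (N : Type) (u : ℕ → N) c d, vapp 2 u (vcons c fun _ => d) ∘ ρ =
      Function.update (val3 c (u 0) d) i (u 1) := by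
    intro N u c d
    funext j
    by_cases hj : j = i
    · subst hj; simp [ρ, vapp]
    · rw [Function.update_of_ne hj]
      rcases j with _ | _ | j <;> simp [ρ, hj, vapp, val3, vcons]
  refine ⟨φ', hφ', fun N B S hS c hc d hd => ?_⟩
  rw [e N B S hS _ (vcons_mem hc fun _ => hd)]
  simp only [satIn_rename, hval, SatIn]
  constructor
  · rintro ⟨u, hu, h⟩
    exact ⟨u 0, hu 0, u 1, hu 1, h⟩
  · rintro ⟨y, hy, z, hz, h⟩
    exact ⟨vcons y fun _ => z, vcons_mem hy fun _ => hz, h⟩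

theorem val3_mem {S : Set N} {x y v : N} (hx : x ∈ S) (hy : y ∈ S) (hv : v ∈ S) (k : ℕ) :
    val3 x y v k ∈ S := by
  unfold val3
  split_ifs <;> assumption

theorem collSScheme_of_sup_elementary {n : ℕ} {A : ArithStr M} (hA : SatPAminus A)
    (H : ∀ (N : Type) (B : ArithStr N) (f : M → N), SatPAminus B → ArithEmb A B f →
      SigmaElemEmb (n + 1) A B f → SigmaElemInTop (n + 1) B (supSet B f)) :
    CollSScheme A (IsSigma (n + 1)) := by
  intro φ hφ _ v p
  by_contra! hcon
  have hx : ∀ q, ∃ x, A.lt x p ∧ (∃ y, Sat A (val3 x y v) φ) ∧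
      ∀ y, A.lt y q → ¬ Sat A (val3 x y v) φ := by
    intro q
    obtain ⟨x, hxp, h | h⟩ := hcon q
    · exact ⟨x, hxp, h⟩
    · obtain ⟨hno, y, -, hy⟩ := h
      exact absurd hy (hno y)
  choose x hxp hex hno using hx
  choose y hy using hex
  obtain ⟨U, hU⟩ := hA.exists_ultrafilter
  have hB := hA.ultrapower U
  have hf := arithEmb_diag A U
  have htop := H _ _ (diag U) hB hf fun χ _ w => sat_diag A U w χ
  have hcut := isCut_supSet hB hf
  let c : (U : Filter M).Germ M := x
  have hval : ∀ g : M → M, val3 c (g : (U : Filter M).Germ M) (diag U v) =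
      fun k => ((fun i => val3 (x i) (g i) v k : M → M) : (U : Filter M).Germ M) := by
    intro g
    funext k
    unfold val3
    split_ifs <;> rfl
  have hcS : c ∈ supSet (ultrapower A U) (diag U) :=
    ⟨p, Filter.Germ.liftRel_coe.2 (.of_forall hxp)⟩
  have hvS := mem_supSet hB hf v
  obtain ⟨χ, hχ, e⟩ := hφ.exists_ex_val3
  have hsat : Sat (ultrapower A U) (vcons c fun _ => diag U v) χ := by
    refine (e _ _ _ (isCut_univ hB) c trivial _ trivial).2 ⟨(y : (U : Filter M).Germ M), trivial, ?_⟩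
    rw [hval]
    exact (sat_ultrapower A U _ φ).2 (.of_forall hy)
  obtain ⟨a, ⟨q, haq⟩, ha⟩ := (e _ _ _ hcut c hcS _ hvS).1
    ((htop χ hχ _ (vcons_mem hcS fun _ => hvS)).2 hsat)
  have ha' := (htop φ hφ _ (val3_mem hcS ⟨q, haq⟩ hvS)).1 ha
  induction a using Filter.Germ.inductionOn with | _ g
  rw [hval, sat_ultrapower] at ha'
  obtain ⟨i, h₁, h₂, h₃⟩ := (ha'.and ((Filter.Germ.liftRel_coe.1 haq).and (hU q))).exists
  exact hno i (g i) (hA.lt_trans h₂ h₃) h₁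

/-- A model M of PA⁻ satisfies Coll_s(Σ_{n+1}) iff for every
model N of PA⁻ with M ≺_{Σ_{n+1}} N one has sup_N(M) ≺_{Σ_{n+1}} N. -/
theorem collS_iff_sup_elementary (n : ℕ) (M : Type) (A : ArithStr M)
    (hA : SatPAminus A) :
    CollSScheme A (IsSigma (n + 1)) ↔
      ∀ (N : Type) (B : ArithStr N) (f : M → N), SatPAminus B →
        ArithEmb A B f → SigmaElemEmb (n + 1) A B f →
        SigmaElemInTop (n + 1) B (supSet B f) := by
  constructor
  · intro hc N B f hB hf hs φ hφ v hv
    exact hc.satIn_supSet_iff hA hB hf hs le_rfl hφ hv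
  · exact collSScheme_of_sup_elementary hA

end FOArith
end
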